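/- arXiv:1312.0240 — 3 statements merged into one kernel-verified Lean document; each statement's English description precedes it below -/
import Mathlib

section
/- Let k be a field of characteristic p > 0 and K/k a finite purely inseparable field extension. Then K/k is modular if and only if for every positive integer i the field K^{p^i} is linearly disjoint from k over K^{p^i} ∩ k (inside K). -/
open scoped TensorProduct

/-- The multiplication map `k(x₁) ⊗ₖ ⋯ ⊗ₖ k(xₙ) → K`. -/
noncomputable def modularMulMap {K L : Type*} [Field K] [Field L] [Algebra K L]
    {n : ℕ} (x : Fin n → L) :
    (⨂[K] i, ↥(IntermediateField.adjoin K {x i})) →ₗ[K] L :=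
  PiTensorProduct.lift ((MultilinearMap.mkPiAlgebra K (Fin n) L).compLinearMap
    fun i => (IntermediateField.adjoin K {x i}).val.toLinearMap)

/-- `L/K` is modular if the multiplication map
`K(x₁) ⊗ₖ ⋯ ⊗ₖ K(xₙ) → L` is an isomorphism (of `K`-algebras) for some `x₁, …, xₙ`. -/
def IsModular (K L : Type*) [Field K] [Field L] [Algebra K L] : Prop :=
  ∃ (n : ℕ) (x : Fin n → L), Function.Bijective (modularMulMap (K := K) x)

/-- A family `v` of elements of `K` is linearly independent over the subset `C ⊆ K`. -/
def LinIndepOver {K : Type*} [Field K] (C : Set K) {ι : Type} (v : ι → K) : Prop :=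
  ∀ c : ι →₀ K, (∀ t, c t ∈ C) → (c.sum fun t r => r * v t) = 0 → c = 0

section Aux
open Module IntermediateField

variable {k K : Type*} [Field k] [Field K] [Algebra k K] [FiniteDimensional k K]

theorem aux_finrank_lt {F G : IntermediateField k K} (h : F < G) : finrank k F < finrank k G := by
  have h2 : Subalgebra.toSubmodule F.toSubalgebra < Subalgebra.toSubmodule G.toSubalgebra := h
  exact Submodule.finrank_lt_finrank_of_lt h2

theorem aux_pow_step [IsPurelyInseparable k K] (p : ℕ) (hp : p.Prime) [ExpChar k p]
    {F G : IntermediateField k K} (h : F < G) {n : ℕ} (hn : p ^ n ≤ finrank k F) :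
    p ^ (n + 1) ≤ finrank k G := by
  have : IsPurelyInseparable k G := IsPurelyInseparable.tower_bot k G K
  obtain ⟨m, hm⟩ := IsPurelyInseparable.finrank_eq_pow k G p
  have h1 := lt_of_le_of_lt hn (aux_finrank_lt h)
  rw [hm] at h1 ⊢
  exact Nat.pow_le_pow_right hp.pos ((Nat.pow_lt_pow_iff_right hp.one_lt).1 h1)

theorem aux_simple_le (x : K) (m : ℕ) (hm : 0 < m) (h : x ^ m ∈ (algebraMap k K).range) :
    finrank k k⟮x⟯ ≤ m := by
  obtain ⟨a, ha⟩ := h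
  rw [adjoin.finrank (Algebra.IsIntegral.isIntegral x)]
  have h1 : (Polynomial.X ^ m - Polynomial.C a).natDegree = m := Polynomial.natDegree_X_pow_sub_C
  rw [← h1]
  apply Polynomial.natDegree_le_of_dvd
  · exact minpoly.dvd k x (by simp [ha])
  · exact Polynomial.X_pow_sub_C_ne_zero hm a

theorem aux_ub (p : ℕ) (hp : p.Prime) {ι : Type*} (u : ι → K) (e : ι → ℕ)
    (h : ∀ j, u j ^ p ^ e j ∈ (algebraMap k K).range) (s : Finset ι) :
    finrank k (adjoin k (u '' s)) ≤ p ^ (∑ j ∈ s, e j) := by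
  classical
  induction s using Finset.induction_on with
  | empty => rw [Finset.coe_empty, Set.image_empty, adjoin_empty, IntermediateField.finrank_bot]; simp
  | insert a s ha ih =>
    rw [Finset.sum_insert ha, pow_add, Finset.coe_insert, Set.image_insert_eq, Set.insert_eq,
      adjoin_union]
    exact (finrank_sup_le _ _).trans
      (Nat.mul_le_mul (aux_simple_le _ _ (pow_pos hp.pos _) (h a)) ih)

theorem aux_frob (p : ℕ) [ExpChar K p] (s : Set K) (G : IntermediateField k K)
    (hG : ∀ y ∈ s, y ^ p ∈ G) {x : K} (hx : x ∈ adjoin k s) : x ^ p ∈ G := by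
  induction hx using adjoin_induction with
  | mem x hx => exact hG x hx
  | algebraMap a => exact pow_mem (G.algebraMap_mem a) p
  | add x y _ _ hx hy => rw [add_pow_expChar]; exact add_mem hx hy
  | inv x _ hx => rw [inv_pow]; exact inv_mem hx
  | mul x y _ _ hx hy => rw [mul_pow]; exact mul_mem hx hy

theorem aux_lemmaA [IsPurelyInseparable k K] (p : ℕ) (hp : p.Prime) [ExpChar k p] [ExpChar K p]
    {ι : Type*} [Fintype ι] (N : ℕ) : ∀ (x : ι → K) (e : ι → ℕ), ∑ j, e j = N →
    (∀ j, 1 ≤ e j) → (∀ j, x j ^ p ^ e j ∈ (algebraMap k K).range) →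
    p ^ Fintype.card ι ≤ finrank k (adjoin k (Set.range fun j => x j ^ p ^ (e j - 1))) →
    p ^ N ≤ finrank k (adjoin k (Set.range x)) := by
  classical
  induction N with
  | zero =>
    intro x e _ _ _ _
    simpa using Nat.one_le_iff_ne_zero.2 (finrank_pos (R := k)).ne'
  | succ N ih =>
    intro x e hN he hx hz
    by_cases hall : ∀ j, e j = 1
    · have hxe : (fun j => x j ^ p ^ (e j - 1)) = x := by funext j; simp [hall j]
      rw [hxe] at hz
      simp only [hall, Finset.sum_const, Finset.card_univ, smul_eq_mul, mul_one] at hN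
      rw [← hN]; exact hz
    push Not at hall
    obtain ⟨i, hi⟩ := hall
    have hi2 : 2 ≤ e i := by have := he i; omega
    set y := Function.update x i (x i ^ p) with hy
    set e' := Function.update e i (e i - 1) with he'
    have hsum : ∑ j, e' j = N := by
      have h1 := Finset.sum_update_of_mem (Finset.mem_univ i) e (e i - 1)
      have h2 := Finset.add_sum_erase Finset.univ e (Finset.mem_univ i)
      rw [Finset.sdiff_singleton_eq_erase] at h1
      change ∑ j, e' j = _ at h1
      omega
    have he1 : ∀ j, 1 ≤ e' j := by
      intro j
      by_cases hj : j = i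
      · subst hj; simp [he']; omega
      · simp [he', hj, he j]
    have hyp : ∀ j, y j ^ p ^ e' j ∈ (algebraMap k K).range := by
      intro j
      by_cases hj : j = i
      · subst hj
        simp only [hy, he', Function.update_self]
        rw [← pow_mul, ← pow_succ', Nat.sub_add_cancel (he j)]; exact hx j
      · simpa [hy, he', hj] using hx j
    have hzeq : (fun j => y j ^ p ^ (e' j - 1)) = fun j => x j ^ p ^ (e j - 1) := by
      funext j
      by_cases hj : j = i
      · subst hj
        simp only [hy, he', Function.update_self]
        rw [← pow_mul, ← pow_succ', Nat.sub_add_cancel (by omega)]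
      · simp [hy, he', hj]
    have key := ih y e' hsum he1 hyp (by rw [hzeq]; exact hz)
    by_cases hmem : x i ∈ adjoin k (Set.range y)
    · exfalso
      set w := Function.update y i (y i ^ p) with hw
      set e'' := Function.update e' i (e' i - 1) with he''
      have hsum' : ∑ j, e'' j + 1 = N := by
        have h1 := Finset.sum_update_of_mem (Finset.mem_univ i) e' (e' i - 1)
        have h2 := Finset.add_sum_erase Finset.univ e' (Finset.mem_univ i)
        have h3 := he1 i
        rw [Finset.sdiff_singleton_eq_erase] at h1
        change ∑ j, e'' j = _ at h1
        omega
      have hwp : ∀ j, w j ^ p ^ e'' j ∈ (algebraMap k K).range := by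
        intro j
        by_cases hj : j = i
        · subst hj
          simp only [hw, he'', Function.update_self]
          rw [← pow_mul, ← pow_succ', Nat.sub_add_cancel (he1 j)]; exact hyp j
        · simpa [hw, he'', hj] using hyp j
      have hub := aux_ub p hp w e'' hwp Finset.univ
      rw [Finset.coe_univ, Set.image_univ] at hub
      have hw' : ∀ j, w j ∈ adjoin k (Set.range w) := fun j => subset_adjoin _ _ ⟨j, rfl⟩
      have hyi : y i ∈ adjoin k (Set.range w) := by
        have : y i = x i ^ p := by simp [hy]
        rw [this]
        refine aux_frob p (Set.range y) _ ?_ hmem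
        rintro _ ⟨j, rfl⟩
        by_cases hj : j = i
        · subst hj; simpa [hw] using hw' j
        · have := pow_mem (hw' j) p
          simpa [hw, hj] using this
      have hle : adjoin k (Set.range y) ≤ adjoin k (Set.range w) := by
        rw [adjoin_le_iff]
        rintro _ ⟨j, rfl⟩
        by_cases hj : j = i
        · subst hj; exact hyi
        · simpa [hw, hj] using hw' j
      have h5 := (key.trans (finrank_le_of_le_right hle)).trans hub
      rw [Nat.pow_le_pow_iff_right hp.one_lt] at h5
      omega
    · refine aux_pow_step p hp (F := adjoin k (Set.range y)) (lt_of_le_of_ne ?_ ?_) key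
      · rw [adjoin_le_iff]
        rintro _ ⟨j, rfl⟩
        have hxj : ∀ j, x j ∈ adjoin k (Set.range x) := fun j => subset_adjoin _ _ ⟨j, rfl⟩
        by_cases hj : j = i
        · subst hj; simpa [hy] using pow_mem (hxj j) p
        · simpa [hy, hj] using hxj j
      · intro heq
        apply hmem
        rw [heq]
        exact subset_adjoin _ _ ⟨i, rfl⟩

end Aux
section Aux2
open Module IntermediateField

theorem aux_linIndepOver_iff {k K : Type*} [Field k] [Field K] [Algebra k K] {ι : Type}
    (v : ι → K) : LinIndepOver (Set.range (algebraMap k K)) v ↔ LinearIndependent k v := by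
  rw [linearIndependent_iff]
  have hinj := (algebraMap k K).injective
  constructor
  · intro h l hl
    have := h (l.mapRange (algebraMap k K) (map_zero _)) (fun t => ⟨l t, by simp⟩) (by
      rw [Finsupp.sum_mapRange_index (by simp)]
      rw [Finsupp.linearCombination_apply] at hl
      simpa [Algebra.smul_def] using hl)
    exact Finsupp.mapRange_injective _ (map_zero _) hinj (by simpa using this)
  · intro h c hc hs
    choose g hg using hc
    have hg0 : ∀ t, g t ≠ 0 → t ∈ c.support := by
      intro t ht
      rw [Finsupp.mem_support_iff, ← hg t]
      simpa using ht
    have hcg : c = (Finsupp.onFinset c.support g hg0).mapRange (algebraMap k K) (map_zero _) := by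
      ext t; simp [hg]
    have h2 := h (Finsupp.onFinset c.support g hg0) (by
      rw [hcg, Finsupp.sum_mapRange_index (by simp)] at hs
      rw [Finsupp.linearCombination_apply]
      simpa [Algebra.smul_def] using hs)
    rw [hcg, h2]; simp

theorem aux_linIndepOver_subfield {K : Type*} [Field K] (C : Subfield K) {ι : Type}
    (v : ι → K) : LinIndepOver (C : Set K) v ↔ LinearIndependent C v := by
  rw [← aux_linIndepOver_iff]
  have : Set.range (algebraMap C K) = (C : Set K) := Subtype.range_coe
  rw [this]

/-- The subfield `K^{p^i}`. -/
noncomputable def auxA (K : Type*) [Field K] (p : ℕ) [ExpChar K p] (i : ℕ) : Subfield K :=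
  (iterateFrobenius K p i).fieldRange

/-- The subfield `K^{p^i} ∩ k`. -/
noncomputable def auxC (k K : Type*) [Field k] [Field K] [Algebra k K] (p : ℕ) [ExpChar K p]
    (i : ℕ) : Subfield K :=
  auxA K p i ⊓ (algebraMap k K).fieldRange

theorem aux_mem_A {K : Type*} [Field K] (p : ℕ) [ExpChar K p] (i : ℕ) (z : K) :
    z ∈ auxA K p i ↔ ∃ w : K, w ^ p ^ i = z := by
  simp [auxA, iterateFrobenius_def]

theorem aux_mem_C {k K : Type*} [Field k] [Field K] [Algebra k K] (p : ℕ) [ExpChar K p] (i : ℕ)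
    (z : K) : z ∈ auxC k K p i ↔ (∃ w : K, w ^ p ^ i = z) ∧ z ∈ (algebraMap k K).range := by
  rw [auxC, Subfield.mem_inf, aux_mem_A]; rfl

theorem aux_coe_C {k K : Type*} [Field k] [Field K] [Algebra k K] (p : ℕ) [ExpChar K p] (i : ℕ) :
    ({z : K | ∃ w : K, w ^ p ^ i = z} ∩ Set.range (algebraMap k K)) = (auxC k K p i : Set K) := by
  ext z
  simp [aux_mem_C]

/-- Frozen-style linear disjointness at level `i`. -/
def AuxDisj (k K : Type*) [Field k] [Field K] [Algebra k K] (p i : ℕ) : Prop :=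
  ∀ (ι : Type) (v : ι → K),
          (∀ t, v t ∈ {z : K | ∃ w : K, w ^ p ^ i = z}) →
          LinIndepOver ({z : K | ∃ w : K, w ^ p ^ i = z} ∩ Set.range (algebraMap k K)) v →
          LinIndepOver (Set.range (algebraMap k K)) v

variable {k K : Type*} [Field k] [Field K] [Algebra k K]

theorem aux_disj_univ (p : ℕ) [ExpChar K p] {i : ℕ} (h : AuxDisj k K p i) {ι : Type*} (v : ι → K)
    (hv : ∀ t, v t ∈ auxA K p i) (hli : LinearIndependent (auxC k K p i) v) :
    LinearIndependent k v := by
  rw [linearIndependent_iff_finset_linearIndependent] at hli ⊢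
  intro s
  rw [← linearIndependent_equiv s.equivFin.symm, ← aux_linIndepOver_iff]
  refine h _ _ (fun t => (aux_mem_A p i _).1 (hv _)) ?_
  rw [aux_coe_C, aux_linIndepOver_subfield, linearIndependent_equiv s.equivFin.symm]
  exact hli s

theorem aux_span_le (p : ℕ) [ExpChar K p] (i : ℕ) (B : Set K) {y : K}
    (hy : y ∈ Submodule.span (auxC k K p i) B) : y ∈ Submodule.span k B := by
  induction hy using Submodule.span_induction with
  | mem x hx => exact Submodule.subset_span hx
  | zero => exact zero_mem _
  | add x y _ _ hx hy => exact add_mem hx hy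
  | smul a x _ hx =>
    obtain ⟨_, b, hb⟩ := (aux_mem_C (k := k) p i (a : K)).1 a.2
    have : a • x = b • x := by rw [Algebra.smul_def b x, hb]; rfl
    rw [this]
    exact Submodule.smul_mem _ _ hx

theorem aux_lemmaD (p : ℕ) [ExpChar K p] {i : ℕ} (h : AuxDisj k K p i) (T : Set K)
    (hT : ∀ t ∈ T, t ∈ auxA K p i) {y : K} (hyA : y ∈ auxA K p i)
    (hy : y ∈ Submodule.span k T) : y ∈ Submodule.span (auxC k K p i) T := by
  by_contra hno
  obtain ⟨B, hBT, hspan, hli⟩ := exists_linearIndependent (auxC k K p i) T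
  have hli' : LinearIndepOn (auxC k K p i) id B := hli
  have hyB : y ∉ B := fun hyB => hno (Submodule.subset_span (hBT hyB))
  have h1 : LinearIndepOn (auxC k K p i) id (insert y B) := by
    apply hli'.insert
    rw [Set.image_id, hspan]; exact hno
  have h2 : LinearIndepOn k id (insert y B) := by
    refine aux_disj_univ p h _ ?_ h1
    rintro ⟨t, ht⟩
    rcases ht with rfl | ht
    · exact hyA
    · exact hT _ (hBT ht)
  have h3 := h2.notMem_span_of_insert hyB
  rw [Set.image_id] at h3
  apply h3
  have : Submodule.span k T ≤ Submodule.span k B := by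
    rw [Submodule.span_le]
    intro t ht
    apply aux_span_le p i
    rw [hspan]; exact Submodule.subset_span ht
  exact this hy

variable [FiniteDimensional k K]

/-- z-field. -/
noncomputable def auxZ (k : Type*) {K : Type*} [Field k] [Field K] [Algebra k K] (p : ℕ)
    (S : Finset (K × ℕ)) : IntermediateField k K :=
  adjoin k ((fun a : K × ℕ => a.1 ^ p ^ (a.2 - 1)) '' S)

theorem aux_extend [IsPurelyInseparable k K] (p : ℕ) (hp : p.Prime) [ExpChar k p] (i : ℕ)
    (d : ℕ) : ∀ (S : Finset (K × ℕ)), finrank k K - finrank k (auxZ k p S) = d →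
    (∀ a ∈ S, i + 1 ≤ a.2 ∧ a.1 ^ p ^ a.2 ∈ (algebraMap k K).range) →
    p ^ S.card ≤ finrank k (auxZ k p S) →
    ∃ S' : Finset (K × ℕ), S ⊆ S' ∧
    (∀ a ∈ S', i + 1 ≤ a.2 ∧ a.1 ^ p ^ a.2 ∈ (algebraMap k K).range) ∧
    p ^ S'.card ≤ finrank k (auxZ k p S') ∧
    ∀ w : K, w ^ p ^ (i + 1) ∈ (algebraMap k K).range → w ^ p ^ i ∈ auxZ k p S' := by
  classical
  induction d using Nat.strong_induction_on with
  | _ d ih =>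
    intro S hd hS hc
    by_cases hall : ∀ w : K, w ^ p ^ (i + 1) ∈ (algebraMap k K).range → w ^ p ^ i ∈ auxZ k p S
    · exact ⟨S, subset_rfl, hS, hc, hall⟩
    push Not at hall
    obtain ⟨w, hw, hwZ⟩ := hall
    have hnot : (w, i + 1) ∉ S := by
      intro hmem
      exact hwZ (subset_adjoin _ _ ⟨(w, i + 1), hmem, by simp⟩)
    have hlt : auxZ k p S < auxZ k p (insert (w, i + 1) S) := by
      refine lt_of_le_of_ne ?_ ?_
      · apply adjoin.mono
        apply Set.image_mono
        simp
      · intro heq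
        apply hwZ
        rw [heq]
        exact subset_adjoin _ _ ⟨(w, i + 1), by simp, by simp⟩
    have hlt' := aux_finrank_lt hlt
    have hle : finrank k (auxZ k p (insert (w, i + 1) S)) ≤ finrank k K :=
      Submodule.finrank_le (Subalgebra.toSubmodule (auxZ k p (insert (w, i + 1) S)).toSubalgebra)
    obtain ⟨S', h1, h2, h3, h4⟩ := ih _ (by omega) (insert (w, i + 1) S) rfl
      (by
        intro a ha
        rcases Finset.mem_insert.1 ha with rfl | ha
        · exact ⟨le_rfl, hw⟩
        · exact hS a ha)
      (by rw [Finset.card_insert_of_notMem hnot]; exact aux_pow_step p hp hlt hc)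
    exact ⟨S', (Finset.subset_insert _ _).trans h1, h2, h3, h4⟩

theorem aux_stage [IsPurelyInseparable k K] (p : ℕ) (hp : p.Prime) [ExpChar k p] [ExpChar K p]
    (i : ℕ) (h : AuxDisj k K p (i + 1)) (S : Finset (K × ℕ))
    (hS : ∀ a ∈ S, i + 1 ≤ a.2 ∧ a.1 ^ p ^ a.2 ∈ (algebraMap k K).range)
    (hc : p ^ S.card ≤ finrank k (auxZ k p S))
    (hgen : ∀ w : K, w ^ p ^ (i + 1) ∈ adjoin k ((fun a : K × ℕ => a.1 ^ p ^ (i + 1)) '' S)) :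
    ∃ S' : Finset (K × ℕ),
    (∀ a ∈ S', i + 1 ≤ a.2 ∧ a.1 ^ p ^ a.2 ∈ (algebraMap k K).range) ∧
    p ^ S'.card ≤ finrank k (auxZ k p S') ∧
    ∀ w : K, w ^ p ^ i ∈ adjoin k ((fun a : K × ℕ => a.1 ^ p ^ i) '' S') := by
  obtain ⟨S', hSS, hS', hc', hE⟩ := aux_extend p hp i _ S rfl hS hc
  refine ⟨S', hS', hc', fun w => ?_⟩
  set G := adjoin k ((fun a : K × ℕ => a.1 ^ p ^ i) '' (S' : Set (K × ℕ))) with hG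
  set T := (fun a : K × ℕ => a.1 ^ p ^ (i + 1)) '' (S : Set (K × ℕ)) with hTdef
  have hZG : auxZ k p S' ≤ G := by
    rw [auxZ, adjoin_le_iff]
    rintro _ ⟨a, ha, rfl⟩
    have h1 : a.1 ^ p ^ i ∈ G := subset_adjoin _ _ ⟨a, ha, rfl⟩
    have h2 := pow_mem h1 (p ^ (a.2 - 1 - i))
    rw [← pow_mul, ← pow_add] at h2
    have h3 := (hS' a ha).1
    rwa [show i + (a.2 - 1 - i) = a.2 - 1 by omega] at h2
  have hw1 : w ^ p ^ (i + 1) ∈ Submodule.span k (Submonoid.closure T : Set K) := by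
    rw [← Algebra.adjoin_eq_span,
      ← IntermediateField.adjoin_toSubalgebra_of_isAlgebraic (fun x _ => Algebra.IsAlgebraic.isAlgebraic x)]
    exact hgen w
  have hcl : ∀ t ∈ Submonoid.closure T, ∃ g ∈ G, g ^ p ^ (i + 1) = t ^ p ^ i ∧ g ^ p = t := by
    intro t ht
    induction ht using Submonoid.closure_induction with
    | mem t ht =>
      obtain ⟨a, ha, rfl⟩ := ht
      refine ⟨a.1 ^ p ^ i, subset_adjoin _ _ ⟨a, hSS ha, rfl⟩, ?_, ?_⟩
      · simp only [← pow_mul, ← pow_add]; congr 2; ring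
      · simp only [← pow_mul, ← pow_succ]
    | one => exact ⟨1, one_mem _, by simp, by simp⟩
    | mul x y _ _ hx hy =>
      obtain ⟨g, hg, h1, h2⟩ := hx
      obtain ⟨g', hg', h1', h2'⟩ := hy
      exact ⟨g * g', mul_mem hg hg', by rw [mul_pow, mul_pow, h1, h1'], by rw [mul_pow, h2, h2']⟩
  have hTA : ∀ t ∈ Submonoid.closure T, t ∈ auxA K p (i + 1) := by
    have : Submonoid.closure T ≤ (auxA K p (i + 1)).toSubmonoid := by
      rw [Submonoid.closure_le]
      rintro _ ⟨a, _, rfl⟩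
      exact (aux_mem_A p (i + 1) _).2 ⟨_, rfl⟩
    exact this
  have hw2 := aux_lemmaD p h _ hTA ((aux_mem_A p (i + 1) _).2 ⟨w, rfl⟩) hw1
  have hroot : ∀ y ∈ Submodule.span (auxC k K p (i + 1)) (Submonoid.closure T : Set K),
      ∃ g ∈ G, g ^ p = y := by
    intro y hy
    induction hy using Submodule.span_induction with
    | mem x hx => obtain ⟨g, hg, _, h2⟩ := hcl x hx; exact ⟨g, hg, h2⟩
    | zero => exact ⟨0, zero_mem _, by simp [hp.ne_zero]⟩
    | add x y _ _ hx hy =>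
      obtain ⟨g, hg, h1⟩ := hx
      obtain ⟨g', hg', h1'⟩ := hy
      exact ⟨g + g', add_mem hg hg', by rw [add_pow_expChar, h1, h1']⟩
    | smul c x _ hx =>
      obtain ⟨g, hg, h1⟩ := hx
      obtain ⟨⟨d, hd⟩, hck⟩ := (aux_mem_C (k := k) p (i + 1) (c : K)).1 c.2
      refine ⟨d ^ p ^ i * g, mul_mem (hZG (hE d (by rw [hd]; exact hck))) hg, ?_⟩
      rw [mul_pow, h1, ← pow_mul, ← pow_succ, hd]; rfl
  obtain ⟨g, hg, h1⟩ := hroot _ hw2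
  have : g = w ^ p ^ i := by
    apply frobenius_inj K p
    rw [frobenius_def, frobenius_def, h1, ← pow_mul, ← pow_succ]
  rwa [← this]

theorem aux_all [IsPurelyInseparable k K] (p : ℕ) (hp : p.Prime) [ExpChar k p] [ExpChar K p]
    (h : ∀ i, 0 < i → AuxDisj k K p i) :
    ∃ S : Finset (K × ℕ),
    (∀ a ∈ S, 1 ≤ a.2 ∧ a.1 ^ p ^ a.2 ∈ (algebraMap k K).range) ∧
    p ^ S.card ≤ finrank k (auxZ k p S) ∧
    adjoin k (Prod.fst '' (S : Set (K × ℕ))) = ⊤ := by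
  obtain ⟨N, hN⟩ := IsPurelyInseparable.HasExponent.has_exponent (K := k) (L := K)
  rw [ringExpChar.eq k p] at hN
  have main : ∀ j, j ≤ N → ∃ S : Finset (K × ℕ),
    (∀ a ∈ S, (N - j) + 1 ≤ a.2 ∧ a.1 ^ p ^ a.2 ∈ (algebraMap k K).range) ∧
    p ^ S.card ≤ finrank k (auxZ k p S) ∧
    ∀ w : K, w ^ p ^ (N - j) ∈ adjoin k ((fun a : K × ℕ => a.1 ^ p ^ (N - j)) '' S) := by
    intro j
    induction j with
    | zero =>
      intro _
      refine ⟨∅, by simp, ?_, ?_⟩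
      · simpa using Nat.one_le_iff_ne_zero.2 (finrank_pos (R := k)).ne'
      · intro w
        obtain ⟨a, ha⟩ := hN w
        rw [Nat.sub_zero, ← ha]
        exact IntermediateField.algebraMap_mem _ _
    | succ j ih =>
      intro hj
      obtain ⟨S, h1, h2, h3⟩ := ih (by omega)
      have e : N - j = (N - (j + 1)) + 1 := by omega
      rw [e] at h1 h3
      exact aux_stage p hp (N - (j + 1)) (h _ (by omega)) S
        (fun a ha => ⟨by have := (h1 a ha).1; omega, (h1 a ha).2⟩) h2 h3
  obtain ⟨S, h1, h2, h3⟩ := main N le_rfl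
  simp only [Nat.sub_self, pow_zero, pow_one, zero_add] at h1 h3
  refine ⟨S, h1, h2, ?_⟩
  rw [eq_top_iff]
  intro w _
  exact h3 w

theorem aux_modular [IsPurelyInseparable k K] (p : ℕ) (hp : p.Prime) [ExpChar k p] [ExpChar K p]
    (h : ∀ i, 0 < i → AuxDisj k K p i) : IsModular k K := by
  obtain ⟨S, hS, hc, htop⟩ := aux_all p hp h
  set x : Fin S.card → K := fun j => (S.equivFin.symm j).1.1 with hx
  set e : Fin S.card → ℕ := fun j => (S.equivFin.symm j).1.2 with he
  have hrange : ∀ f : K × ℕ → K, Set.range (fun j => f (S.equivFin.symm j).1) = f '' S := by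
    intro f
    ext z
    constructor
    · rintro ⟨j, rfl⟩
      exact ⟨_, (S.equivFin.symm j).2, rfl⟩
    · rintro ⟨a, ha, rfl⟩
      exact ⟨S.equivFin ⟨a, ha⟩, by simp⟩
  have hxtop : adjoin k (Set.range x) = ⊤ := by rw [← htop, ← hrange Prod.fst]
  have hxe : ∀ j, x j ^ p ^ e j ∈ (algebraMap k K).range := fun j => (hS _ (S.equivFin.symm j).2).2
  have hA := aux_lemmaA p hp (k := k) (∑ j, e j) x e rfl (fun j => (hS _ (S.equivFin.symm j).2).1)
    hxe (by
      rw [Fintype.card_fin, hrange (fun a => a.1 ^ p ^ (a.2 - 1))]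
      exact hc)
  rw [hxtop, finrank_top'] at hA
  refine ⟨S.card, x, ?_⟩
  have hsurj : Function.Surjective (modularMulMap (K := k) x) := by
    rw [← LinearMap.range_eq_top, eq_top_iff]
    have h1 : (⊤ : Submodule k K) = Submodule.span k (Submonoid.closure (Set.range x) : Set K) := by
      rw [← Algebra.adjoin_eq_span,
        ← IntermediateField.adjoin_toSubalgebra_of_isAlgebraic (fun x _ => Algebra.IsAlgebraic.isAlgebraic x), hxtop]
      rfl
    rw [h1, Submodule.span_le]
    intro t ht
    have : ∃ f : ∀ j, adjoin k {x j}, ∏ j, (f j : K) = t := by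
      induction ht using Submonoid.closure_induction with
      | mem t ht =>
        obtain ⟨j, rfl⟩ := ht
        refine ⟨Pi.mulSingle j (AdjoinSimple.gen k (x j)), ?_⟩
        rw [Finset.prod_eq_single j]
        · simp
        · intro b _ hb; simp [Pi.mulSingle_eq_of_ne hb]
        · simp
      | one => exact ⟨1, by simp⟩
      | mul a b _ _ ha hb =>
        obtain ⟨f, rfl⟩ := ha
        obtain ⟨g, rfl⟩ := hb
        exact ⟨f * g, by simp [Finset.prod_mul_distrib]⟩
    obtain ⟨f, hf⟩ := this
    refine ⟨PiTensorProduct.tprod k f, ?_⟩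
    rw [← hf]
    simp [modularMulMap]
  have b := Basis.piTensorProduct (fun j : Fin S.card => finBasis k (adjoin k {x j}))
  have : FiniteDimensional k (⨂[k] i, ↥(IntermediateField.adjoin k {x i})) := Module.Finite.of_basis b
  have hfr : finrank k (⨂[k] i, ↥(IntermediateField.adjoin k {x i})) ≤ p ^ ∑ j, e j := by
    rw [finrank_eq_card_basis b, Fintype.card_pi, ← Finset.prod_pow_eq_pow_sum]
    apply Finset.prod_le_prod'
    intro j _
    rw [Fintype.card_fin]
    exact aux_simple_le _ _ (pow_pos hp.pos _) (hxe j)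
  have hge := LinearMap.finrank_le_finrank_of_surjective hsurj
  exact ⟨(LinearMap.injective_iff_surjective_of_finrank_eq_finrank
    (le_antisymm (hfr.trans hA) hge)).2 hsurj, hsurj⟩

end Aux2
section Aux3
open Module IntermediateField

theorem aux_lemmaE {k K : Type*} [Field k] [Field K] [Algebra k K] (p : ℕ) [ExpChar K p] (i : ℕ)
    {κ : Type} (b : κ → K) (hbA : ∀ t, b t ∈ auxA K p i) (hb : LinearIndependent k b)
    (hspan : ∀ y ∈ auxA K p i, y ∈ Submodule.span (auxC k K p i) (Set.range b)) :
    AuxDisj k K p i := by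
  intro ι v hv hli
  rw [aux_coe_C, aux_linIndepOver_subfield] at hli
  have hCA : auxC k K p i ≤ auxA K p i := inf_le_left
  have hCR : auxC k K p i ≤ (algebraMap k K).fieldRange := inf_le_right
  rw [← aux_linIndepOver_iff] at hb
  have hbC : LinearIndependent (auxC k K p i) b := by
    rw [← aux_linIndepOver_subfield]
    intro c hc hs
    exact hb c (fun t => hCR (hc t)) hs
  let A' := Subfield.extendScalars hCA
  let R' := Subfield.extendScalars hCR
  have hR : Set.range (algebraMap R' K) = Set.range (algebraMap k K) := by
    ext z
    constructor
    · rintro ⟨r, rfl⟩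
      exact r.2
    · intro hz
      exact ⟨⟨z, hz⟩, rfl⟩
  let b' : κ → A' := fun t => ⟨b t, hbA t⟩
  have hb' : LinearIndependent (auxC k K p i) b' :=
    LinearIndependent.of_comp A'.val.toLinearMap hbC
  have hsp : ⊤ ≤ Submodule.span (auxC k K p i) (Set.range b') := by
    rintro ⟨y, hyA⟩ -
    have h1 := hspan y hyA
    have h2 : Set.range b = A'.val.toLinearMap '' Set.range b' := by
      rw [← Set.range_comp]; rfl
    rw [h2, Submodule.span_image] at h1
    obtain ⟨z, hz, hzy⟩ := h1
    have : z = ⟨y, hyA⟩ := Subtype.ext hzy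
    rwa [← this]
  have hdis : A'.LinearDisjoint R' := by
    apply LinearDisjoint.of_basis_left (Basis.mk hb' hsp)
    have : (⇑A'.val ∘ ⇑(Basis.mk hb' hsp)) = b := by
      rw [Basis.coe_mk]; rfl
    rw [this, ← aux_linIndepOver_iff, hR]
    exact hb
  let v' : ι → A' := fun t => ⟨v t, (aux_mem_A p i _).2 (hv t)⟩
  have hv' : LinearIndependent (auxC k K p i) v' :=
    LinearIndependent.of_comp A'.val.toLinearMap hli
  have := hdis.linearIndependent_left hv'
  rw [← aux_linIndepOver_iff, hR] at this
  exact this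

theorem aux_of_modular {k K : Type*} [Field k] [Field K] [Algebra k K] [FiniteDimensional k K]
    [IsPurelyInseparable k K] (p : ℕ) (hp : p.Prime) [ExpChar k p] [ExpChar K p]
    (h : IsModular k K) (i : ℕ) : AuxDisj k K p i := by
  obtain ⟨n, x, hbij⟩ := h
  have hint : ∀ j, IsIntegral k (x j) := fun j => Algebra.IsIntegral.isIntegral _
  let E : Fin n → ℕ := fun j => IsPurelyInseparable.elemExponent k (x j)
  have hdeg : ∀ j, (minpoly k (x j)).natDegree = p ^ E j := fun j =>
    IsPurelyInseparable.minpoly_natDegree_eq' k p (x j)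
  have hE : ∀ j, x j ^ p ^ E j ∈ (algebraMap k K).range := fun j =>
    ⟨_, IsPurelyInseparable.algebraMap_elemReduct_eq' k p (x j)⟩
  let B := (Basis.piTensorProduct (fun j => powerBasisAux (hint j))).map
    (LinearEquiv.ofBijective _ hbij)
  have hB : ∀ α, B α = ∏ j, x j ^ (α j : ℕ) := by
    intro α
    have : ∀ j, ((powerBasisAux (hint j) (α j) : adjoin k {x j}) : K) = x j ^ (α j : ℕ) := by
      intro j
      have := (adjoin.powerBasis (hint j)).basis_eq_pow (α j)
      have h2 : (powerBasisAux (hint j) (α j) : adjoin k {x j}) =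
        (adjoin.powerBasis (hint j)).gen ^ (α j : ℕ) := this
      rw [h2]
      simp
    simp [B, modularMulMap, this]
  let κ := {α // B α ∈ auxA K p i}
  refine aux_lemmaE (k := k) p i (κ := κ) (fun α => B α.1) (fun α => α.2)
    (B.linearIndependent.comp _ Subtype.val_injective) ?_
  intro y hy
  obtain ⟨w, rfl⟩ := (aux_mem_A p i y).1 hy
  have hw : w ^ p ^ i = ∑ α, algebraMap k K (B.repr w α) ^ p ^ i * (B α) ^ p ^ i := by
    conv_lhs => rw [← B.sum_repr w]
    rw [← iterateFrobenius_def, map_sum]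
    simp [Algebra.smul_def, mul_pow, iterateFrobenius_def]
  rw [hw]
  refine sum_mem fun α _ => ?_
  have step : ∀ j, ∃ (s : K) (r : ℕ), s ∈ auxC k K p i ∧ r < p ^ E j ∧ x j ^ r ∈ auxA K p i ∧
      (x j ^ (α j : ℕ)) ^ p ^ i = s * x j ^ r := by
    intro j
    rcases le_total (E j) i with hij | hij
    · refine ⟨(x j ^ (α j : ℕ)) ^ p ^ i, 0, ?_, pow_pos hp.pos _, ?_, by simp⟩
      · rw [aux_mem_C]
        refine ⟨⟨_, rfl⟩, ?_⟩
        obtain ⟨d, rfl⟩ := Nat.exists_eq_add_of_le hij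
        have : (x j ^ (α j : ℕ)) ^ p ^ (E j + d) = (x j ^ p ^ E j) ^ (α j * p ^ d) := by
          rw [← pow_mul, ← pow_mul]; congr 1; ring
        rw [this]
        exact pow_mem (hE j) _
      · simp
    · obtain ⟨d, hd⟩ := Nat.exists_eq_add_of_le hij
      refine ⟨(x j ^ p ^ E j) ^ ((α j : ℕ) / p ^ d), p ^ i * ((α j : ℕ) % p ^ d), ?_, ?_, ?_, ?_⟩
      · rw [aux_mem_C]
        refine ⟨⟨(x j ^ p ^ d) ^ ((α j : ℕ) / p ^ d), ?_⟩, pow_mem (hE j) _⟩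
        rw [hd]
        simp only [← pow_mul]; congr 1; ring
      · rw [hd, pow_add]
        exact Nat.mul_lt_mul_of_pos_left (Nat.mod_lt _ (pow_pos hp.pos _)) (pow_pos hp.pos _)
      · rw [aux_mem_A]
        exact ⟨x j ^ ((α j : ℕ) % p ^ d), by rw [← pow_mul, mul_comm]⟩
      · rw [hd, ← pow_mul, ← pow_mul, ← pow_add]
        congr 1
        conv_lhs => rw [← Nat.div_add_mod (α j : ℕ) (p ^ d)]
        ring
  choose s r hs hr hxr heq using step
  let β : ∀ j, Fin (minpoly k (x j)).natDegree := fun j => ⟨r j, by rw [hdeg]; exact hr j⟩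
  have hβ : B β = ∏ j, x j ^ r j := hB β
  have hβA : B β ∈ auxA K p i := by rw [hβ]; exact prod_mem fun j _ => hxr j
  have hprod : (B α) ^ p ^ i = (∏ j, s j) * B β := by
    rw [hB, hβ, ← Finset.prod_pow, ← Finset.prod_mul_distrib]
    exact Finset.prod_congr rfl fun j _ => heq j
  have hcoef : algebraMap k K (B.repr w α) ^ p ^ i * ∏ j, s j ∈ auxC k K p i := by
    refine mul_mem ?_ (prod_mem fun j _ => hs j)
    rw [aux_mem_C]
    exact ⟨⟨_, rfl⟩, _, map_pow _ _ _⟩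
  rw [hprod, ← mul_assoc]
  exact Submodule.smul_mem _ (⟨_, hcoef⟩ : auxC k K p i) (Submodule.subset_span ⟨⟨β, hβA⟩, rfl⟩)

end Aux3

/-- **Sweedler.** A finite purely inseparable extension `K/k` in
characteristic `p > 0` is modular iff for every `i > 0` the field `K^{pⁱ}` is linearly
disjoint from `k` over `K^{pⁱ} ∩ k`. -/
theorem isModular_iff_linearlyDisjoint
    (k K : Type*) [Field k] [Field K] [Algebra k K] [FiniteDimensional k K]
    (p : ℕ) (hp : p.Prime) [CharP k p]
    (hins : ∀ y : K, ∃ m : ℕ, y ^ p ^ m ∈ (algebraMap k K).range) :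
    IsModular k K ↔
      ∀ i : ℕ, 0 < i →
        ∀ (ι : Type) (v : ι → K),
          (∀ t, v t ∈ {z : K | ∃ w : K, w ^ p ^ i = z}) →
          LinIndepOver ({z : K | ∃ w : K, w ^ p ^ i = z} ∩ Set.range (algebraMap k K)) v →
          LinIndepOver (Set.range (algebraMap k K)) v := by
  have hchar : CharP K p := charP_of_injective_algebraMap (algebraMap k K).injective p
  have hf : Fact p.Prime := ⟨hp⟩
  have e1 : ExpChar k p := ExpChar.prime hp
  have e2 : ExpChar K p := ExpChar.prime hp
  have hpi : IsPurelyInseparable k K := (isPurelyInseparable_iff_pow_mem k p).2 hins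
  exact ⟨fun h i _ => aux_of_modular p hp h i, fun h => aux_modular p hp h⟩
end

section
/- Let K be a field of characteristic p > 0 and L/K a finite purely inseparable field extension of exponent e. Then L/K is modular if and only if for every i with 0 < i ≤ e − 1 the set A_{L/K,i} spans Diff^{p^i}_K L as an L-vector subspace of End_K L (equivalently, the multiplication map L ⊗_{L^{p^i}} A_{L/K,i} → Diff^{p^i}_K L is surjective). -/
open scoped TensorProduct

/-- `D` is a differential operator of order ≤ n over K: all iterated commutators
`[[⋯[D, a₀], a₁]⋯, aₙ]` with `n + 1` multiplication operators vanish. -/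
def IsDiffOpLE (K M : Type*) [CommSemiring K] [CommRing M] [Algebra K M]
    (n : ℕ) (D : M →ₗ[K] M) : Prop :=
  ∀ a : Fin (n + 1) → M,
    (List.ofFn a).foldl
      (fun E c => E ∘ₗ LinearMap.mulLeft K c - LinearMap.mulLeft K c ∘ₗ E) D = 0

/-- `A_{L/K,i}`: differential operators of order ≤ pⁱ with `D(L^{pʲ}) ⊆ L^{pʲ}`
for all `j ≤ i`. -/
def Adiff (K L : Type*) [Field K] [Field L] [Algebra K L] (p i : ℕ) :
    Set (L →ₗ[K] L) :=
  {D | IsDiffOpLE K L (p ^ i) D ∧ ∀ j ≤ i, ∀ y : L, ∃ z : L, D (y ^ p ^ j) = z ^ p ^ j}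

namespace ModDiff

lemma sub_pow_aux {R : Type*} [Ring R] (p N : ℕ) [Fact p.Prime] [CharP R p] (A B : R)
    (h : A * B = B * A) : (A - B) ^ p ^ N = A ^ p ^ N - B ^ p ^ N := by
  have h' : Commute A B := h
  exact sub_pow_char_pow_of_commute p N h'

section Ops
variable {K M : Type*} [CommRing K] [CommRing M] [Algebra K M]

/-- commutator with multiplication by `c` -/
def adc (E : M →ₗ[K] M) (c : M) : M →ₗ[K] M :=
  E ∘ₗ LinearMap.mulLeft K c - LinearMap.mulLeft K c ∘ₗ E

@[simp] lemma adc_apply (E : M →ₗ[K] M) (c y : M) : adc E c y = E (c * y) - c * E y := by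
  simp [adc]

lemma isDiff_def (n : ℕ) (D : M →ₗ[K] M) :
    IsDiffOpLE K M n D ↔ ∀ a : Fin (n + 1) → M, (List.ofFn a).foldl adc D = 0 := Iff.rfl

lemma isDiff_zero (D : M →ₗ[K] M) : IsDiffOpLE K M 0 D ↔ ∀ a, adc D a = 0 := by
  rw [isDiff_def]
  constructor
  · intro h a
    simpa using h (fun _ => a)
  · intro h a
    simpa using h (a 0)

lemma isDiff_succ (n : ℕ) (D : M →ₗ[K] M) :
    IsDiffOpLE K M (n + 1) D ↔ ∀ a, IsDiffOpLE K M n (adc D a) := by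
  simp only [isDiff_def]
  constructor
  · intro h a b
    have := h (Fin.cons a b)
    rw [List.ofFn_succ] at this
    simpa using this
  · intro h a
    rw [List.ofFn_succ]
    exact h (a 0) (fun i => a i.succ)

lemma adc_zero (c : M) : adc (0 : M →ₗ[K] M) c = 0 := by ext; simp

lemma isDiff_zero_map (n : ℕ) : IsDiffOpLE K M n 0 := by
  induction n with
  | zero => rw [isDiff_zero]; exact adc_zero
  | succ n ih => rw [isDiff_succ]; intro a; rw [adc_zero]; exact ih

lemma isDiff_add (n : ℕ) (D E : M →ₗ[K] M) (hD : IsDiffOpLE K M n D) (hE : IsDiffOpLE K M n E) :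
    IsDiffOpLE K M n (D + E) := by
  have key : ∀ (D E : M →ₗ[K] M) a, adc (D + E) a = adc D a + adc E a := by
    intro D E a; ext y; simp; ring
  induction n generalizing D E with
  | zero => rw [isDiff_zero] at *; intro a; rw [key, hD, hE, add_zero]
  | succ n ih => rw [isDiff_succ] at *; intro a; rw [key]; exact ih _ _ (hD a) (hE a)

lemma isDiff_smul (n : ℕ) (c : M) (D : M →ₗ[K] M) (hD : IsDiffOpLE K M n D) :
    IsDiffOpLE K M n (c • D) := by
  have key : ∀ (D : M →ₗ[K] M) a, adc (c • D) a = c • adc D a := by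
    intro D a; ext y; simp; ring
  induction n generalizing D with
  | zero => rw [isDiff_zero] at *; intro a; rw [key, hD, smul_zero]
  | succ n ih => rw [isDiff_succ] at *; intro a; rw [key]; exact ih _ (hD a)

lemma isDiff_comp (n : ℕ) (c : M) (D : M →ₗ[K] M) (hD : IsDiffOpLE K M n D) :
    IsDiffOpLE K M n (D ∘ₗ LinearMap.mulLeft K c) := by
  have key : ∀ (D : M →ₗ[K] M) a, adc (D ∘ₗ LinearMap.mulLeft K c) a
      = adc D a ∘ₗ LinearMap.mulLeft K c := by
    intro D a; ext y; simp [mul_left_comm]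
  induction n generalizing D with
  | zero => rw [isDiff_zero] at *; intro a; rw [key, hD, LinearMap.zero_comp]
  | succ n ih => rw [isDiff_succ] at *; intro a; rw [key]; exact ih _ (hD a)

lemma isDiff_id (n : ℕ) : IsDiffOpLE K M n LinearMap.id := by
  have : ∀ a, adc (LinearMap.id : M →ₗ[K] M) a = 0 := by intro a; ext; simp
  cases n with
  | zero => rw [isDiff_zero]; exact this
  | succ n => rw [isDiff_succ]; intro a; rw [this]; exact isDiff_zero_map n

lemma isDiff_mono_succ (n : ℕ) (D : M →ₗ[K] M) (hD : IsDiffOpLE K M n D) :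
    IsDiffOpLE K M (n + 1) D := by
  induction n generalizing D with
  | zero =>
    rw [isDiff_zero] at hD
    rw [isDiff_succ]; intro a; rw [hD]; exact isDiff_zero_map _
  | succ n ih =>
    rw [isDiff_succ] at *
    intro a; exact ih _ (hD a)

lemma isDiff_mono {m n : ℕ} (h : m ≤ n) (D : M →ₗ[K] M) (hD : IsDiffOpLE K M m D) :
    IsDiffOpLE K M n D := by
  induction h with
  | refl => exact hD
  | step _ ih => exact isDiff_mono_succ _ _ ih

lemma foldl_adc_zero (l : List M) : l.foldl adc (0 : M →ₗ[K] M) = 0 := by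
  induction l with
  | nil => rfl
  | cons a l ih => rw [List.foldl_cons, adc_zero, ih]

lemma isDiff_list (n : ℕ) (D : M →ₗ[K] M) (hD : IsDiffOpLE K M n D) (l : List M)
    (hl : n < l.length) : l.foldl adc D = 0 := by
  induction n generalizing D l with
  | zero =>
    rw [isDiff_zero] at hD
    cases l with
    | nil => simp at hl
    | cons a l => rw [List.foldl_cons, hD, foldl_adc_zero]
  | succ n ih =>
    rw [isDiff_succ] at hD
    cases l with
    | nil => simp at hl
    | cons a l =>
      rw [List.foldl_cons]
      exact ih _ (hD a) l (by simpa using hl)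

/-- it suffices to check commutators on generators -/
lemma isDiff_of_gen (n : ℕ) (D : M →ₗ[K] M) (S : Set M)
    (hS : ∀ a ∈ S, IsDiffOpLE K M n (adc D a)) (hgen : Subring.closure S = ⊤) :
    IsDiffOpLE K M (n + 1) D := by
  rw [isDiff_succ]
  intro a
  have ha : a ∈ Subring.closure S := by rw [hgen]; trivial
  induction ha using Subring.closure_induction with
  | mem x hx => exact hS x hx
  | zero =>
    have : adc D 0 = 0 := by ext; simp
    rw [this]; exact isDiff_zero_map n
  | one =>
    have : adc D 1 = 0 := by ext; simp
    rw [this]; exact isDiff_zero_map n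
  | add x y _ _ hx hy =>
    have : adc D (x + y) = adc D x + adc D y := by ext; simp [add_mul]; ring
    rw [this]; exact isDiff_add n _ _ hx hy
  | neg x _ hx =>
    have : adc D (-x) = (-1 : M) • adc D x := by ext; simp; ring
    rw [this]; exact isDiff_smul n _ _ hx
  | mul x y _ _ hx hy =>
    have : adc D (x * y) = adc D x ∘ₗ LinearMap.mulLeft K y + x • adc D y := by
      ext z; simp [mul_assoc]; ring
    rw [this]; exact isDiff_add n _ _ (isDiff_comp n _ _ hx) (isDiff_smul n _ _ hy)

lemma isDiff_sub (n : ℕ) (D E : M →ₗ[K] M) (hD : IsDiffOpLE K M n D) (hE : IsDiffOpLE K M n E) :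
    IsDiffOpLE K M n (D - E) := by
  have : D - E = D + (-1 : M) • E := by ext; simp; ring
  rw [this]; exact isDiff_add n _ _ hD (isDiff_smul n _ _ hE)

lemma adc_iter (D : M →ₗ[K] M) (a : M) (n : ℕ) (y : M) :
    (List.replicate n a).foldl adc D y
      = ((LinearMap.mulRight K (LinearMap.mulLeft K a) - LinearMap.mulLeft K (LinearMap.mulLeft K a)
        : Module.End K (Module.End K M)) ^ n) D y := by
  congr 1
  induction n generalizing D with
  | zero => simp
  | succ n ih =>
    rw [List.replicate_succ, List.foldl_cons, ih, pow_succ, Module.End.mul_apply]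
    rfl

/-- operators of order `≤ n` commute with `p^N`-th powers if `n < p^N` -/
lemma isDiff_comm_pow (p : ℕ) [Fact p.Prime] [CharP K p] (N n : ℕ) (hn : n < p ^ N)
    (D : M →ₗ[K] M) (hD : IsDiffOpLE K M n D) (a y : M) :
    D (a ^ p ^ N * y) = a ^ p ^ N * D y := by
  have h := isDiff_list n D hD (List.replicate (p ^ N) a) (by simpa using hn)
  have h2 := adc_iter D a (p ^ N) y
  rw [h] at h2
  by_cases hM : Subsingleton M
  · exact Subsingleton.elim _ _
  by_cases hD0 : D = 0
  · simp [hD0]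
  rw [← sub_eq_zero]
  have key : ∀ A B : Module.End K (Module.End K M), CharP (Module.End K (Module.End K M)) p →
      A * B = B * A → (A - B) ^ p ^ N = A ^ p ^ N - B ^ p ^ N := by
    intro A B _ hAB
    exact sub_pow_aux p N A B hAB
  have hp0 : (p : Module.End K (Module.End K M)) = 0 := by
    have : (p : K) = 0 := CharP.cast_eq_zero K p
    rw [← map_natCast (algebraMap K (Module.End K (Module.End K M))), this, map_zero]
  have : CharP (Module.End K (Module.End K M)) p := by
    have : Nontrivial (Module.End K (Module.End K M)) :=
      ⟨1, 0, fun h => hD0 (by simpa using congrArg (fun f => f D) h)⟩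
    exact (CharP.charP_iff_prime_eq_zero (Fact.out : p.Prime)).2 hp0
  have h3 := key (LinearMap.mulRight K (LinearMap.mulLeft K a))
    (LinearMap.mulLeft K (LinearMap.mulLeft K a)) this (by ext E z; simp)
  rw [LinearMap.pow_mulRight, LinearMap.pow_mulLeft, LinearMap.pow_mulLeft] at h3
  have h4 := h2.trans (congrArg (fun f => f D y) h3)
  simpa using h4.symm

end Ops

end ModDiff

namespace ModDiff

section Mono
variable {K L : Type*} [Field K] [Field L] [Algebra K L]

/-- monomials -/
def mono {n : ℕ} (x : Fin n → L) (γ : Fin n → ℕ) : L := ∏ j, x j ^ γ j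

lemma mono_reduce {n : ℕ} (x : Fin n → L) (q : Fin n → ℕ) (a : Fin n → K)
    (hx : ∀ j, x j ^ q j = algebraMap K L (a j)) (γ : Fin n → ℕ) :
    mono x γ = (∏ j, a j ^ (γ j / q j)) • mono x (fun j => γ j % q j) := by
  rw [Algebra.smul_def, map_prod, mono, mono, ← Finset.prod_mul_distrib]
  refine Finset.prod_congr rfl fun j _ => ?_
  rw [map_pow, ← hx, ← pow_mul, ← pow_add, Nat.div_add_mod]

lemma mono_mem_span {n : ℕ} (x : Fin n → L) (q : Fin n → ℕ) (hq : ∀ j, 0 < q j)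
    (hx : ∀ j, x j ^ q j ∈ (algebraMap K L).range) (γ : Fin n → ℕ) :
    mono x γ ∈ Submodule.span K
      (Set.range fun β : (j : Fin n) → Fin (q j) => mono x (fun j => (β j : ℕ))) := by
  choose a ha using hx
  rw [mono_reduce x q a (fun j => (ha j).symm)]
  exact Submodule.smul_mem _ _ (Submodule.subset_span ⟨fun j => ⟨γ j % q j, Nat.mod_lt _ (hq j)⟩, rfl⟩)

lemma adjoin_eq_span [Algebra.IsAlgebraic K L] {n : ℕ} (x : Fin n → L) (q : Fin n → ℕ) (hq : ∀ j, 0 < q j)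
    (hx : ∀ j, x j ^ q j ∈ (algebraMap K L).range) (z : L) :
    z ∈ IntermediateField.adjoin K (Set.range x) ↔ z ∈ Submodule.span K
      (Set.range fun β : (j : Fin n) → Fin (q j) => mono x (fun j => (β j : ℕ))) := by
  constructor
  · intro hz
    rw [← IntermediateField.mem_toSubalgebra, IntermediateField.adjoin_toSubalgebra,
      ← Subalgebra.mem_toSubmodule, Algebra.adjoin_eq_span] at hz
    refine Submodule.span_le.2 ?_ hz
    intro w hw
    have : ∃ γ, w = mono x γ := by
      induction hw using Submonoid.closure_induction with
      | mem w hw =>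
        obtain ⟨j, rfl⟩ := hw
        refine ⟨Pi.single j 1, ?_⟩
        rw [mono, Finset.prod_eq_single j] <;> simp +contextual [Pi.single_apply]
      | one => exact ⟨0, by simp [mono]⟩
      | mul a b _ _ ha hb =>
        obtain ⟨γ, rfl⟩ := ha
        obtain ⟨δ, rfl⟩ := hb
        exact ⟨γ + δ, by simp [mono, pow_add, Finset.prod_mul_distrib]⟩
    obtain ⟨γ, rfl⟩ := this
    exact mono_mem_span x q hq hx γ
  · intro hz
    have : Submodule.span K
      (Set.range fun β : (j : Fin n) → Fin (q j) => mono x (fun j => (β j : ℕ))) ≤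
        Subalgebra.toSubmodule (IntermediateField.adjoin K (Set.range x)).toSubalgebra := by
      rw [Submodule.span_le]
      rintro _ ⟨β, rfl⟩
      exact prod_mem (B := IntermediateField K L) fun j _ => pow_mem
        (IntermediateField.subset_adjoin K _ (Set.mem_range_self j)) _
    exact this hz

lemma mono_linearIndependent [FiniteDimensional K L] {n : ℕ} (x : Fin n → L) (q : Fin n → ℕ)
    (hq : ∀ j, 0 < q j)
    (hx : ∀ j, x j ^ q j ∈ (algebraMap K L).range)
    (hr : Module.finrank K (IntermediateField.adjoin K (Set.range x)) = ∏ j, q j) :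
    LinearIndependent K (fun β : (j : Fin n) → Fin (q j) => mono x (fun j => (β j : ℕ))) := by
  rw [linearIndependent_iff_card_eq_finrank_span]
  have : Submodule.span K
      (Set.range fun β : (j : Fin n) → Fin (q j) => mono x (fun j => (β j : ℕ))) =
        Subalgebra.toSubmodule (IntermediateField.adjoin K (Set.range x)).toSubalgebra := by
    ext z; exact (adjoin_eq_span x q hq hx z).symm
  rw [Set.finrank, this]
  simp only [Fintype.card_pi, Fintype.card_fin]
  exact hr.symm

/-- Box generation: `L` is a tensor product of simple extensions, numerically. -/
structure Box (K L : Type*) [Field K] [Field L] [Algebra K L] (p : ℕ) {n : ℕ}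
    (x : Fin n → L) (ε : Fin n → ℕ) : Prop where
  mem : ∀ j, x j ^ p ^ ε j ∈ (algebraMap K L).range
  top : IntermediateField.adjoin K (Set.range x) = ⊤
  rank : Module.finrank K L = ∏ j, p ^ ε j

lemma Box.li [FiniteDimensional K L] {p n : ℕ} (hp : 0 < p) {x : Fin n → L} {ε : Fin n → ℕ}
    (h : Box K L p x ε) :
    LinearIndependent K (fun β : (j : Fin n) → Fin (p ^ ε j) => mono x (fun j => (β j : ℕ))) := by
  refine mono_linearIndependent x _ (fun j => by positivity) h.mem ?_
  rw [h.top, IntermediateField.finrank_top', h.rank]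

lemma Box.span [FiniteDimensional K L] {p n : ℕ} (hp : 0 < p) {x : Fin n → L} {ε : Fin n → ℕ}
    (h : Box K L p x ε) :
    ⊤ ≤ Submodule.span K (Set.range
      (fun β : (j : Fin n) → Fin (p ^ ε j) => mono x (fun j => (β j : ℕ)))) := by
  intro z _
  rw [← adjoin_eq_span x _ (fun j => by positivity) h.mem, h.top]
  trivial

/-- monomial basis -/
noncomputable def Box.basis [FiniteDimensional K L] {p n : ℕ} (hp : 0 < p) {x : Fin n → L}
    {ε : Fin n → ℕ} (h : Box K L p x ε) :
    Module.Basis ((j : Fin n) → Fin (p ^ ε j)) K L :=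
  Module.Basis.mk (h.li hp) (h.span hp)

lemma Box.basis_apply [FiniteDimensional K L] {p n : ℕ} (hp : 0 < p) {x : Fin n → L}
    {ε : Fin n → ℕ} (h : Box K L p x ε) (β) :
    h.basis hp β = mono x (fun j => (β j : ℕ)) := by
  simp [Box.basis]

lemma modularMulMap_tprod {n : ℕ} (x : Fin n → L)
    (f : ∀ i, IntermediateField.adjoin K {x i}) :
    modularMulMap (K := K) x (PiTensorProduct.tprod K f) = ∏ i, (f i : L) := by
  simp [modularMulMap]

lemma finrank_pi {n : ℕ} [FiniteDimensional K L] (x : Fin n → L) :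
    Module.finrank K (⨂[K] i, ↥(IntermediateField.adjoin K {x i}))
      = ∏ i, Module.finrank K (IntermediateField.adjoin K {x i}) := by
  rw [Module.finrank_eq_card_basis (Basis.piTensorProduct
    (fun i => Module.finBasis K (IntermediateField.adjoin K {x i})))]
  simp

lemma mulMap_surj {n : ℕ} [FiniteDimensional K L] (x : Fin n → L)
    (htop : IntermediateField.adjoin K (Set.range x) = ⊤) :
    Function.Surjective (modularMulMap (K := K) x) := by
  have hpos : ∀ j, 0 < (minpoly K (x j)).natDegree := fun j =>
    minpoly.natDegree_pos (Algebra.IsIntegral.isIntegral (x j))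
  rw [← LinearMap.range_eq_top, eq_top_iff]
  intro z _
  have hz : z ∈ IntermediateField.adjoin K (Set.range x) := by rw [htop]; trivial
  rw [← IntermediateField.mem_toSubalgebra, IntermediateField.adjoin_toSubalgebra,
      ← Subalgebra.mem_toSubmodule, Algebra.adjoin_eq_span] at hz
  refine Submodule.span_le.2 ?_ hz
  intro w hw
  have : ∃ f : ∀ i, IntermediateField.adjoin K {x i}, w = ∏ i, (f i : L) := by
      induction hw using Submonoid.closure_induction with
      | mem w hw =>
        obtain ⟨j, rfl⟩ := hw
        refine ⟨Pi.mulSingle j ⟨x j, IntermediateField.mem_adjoin_simple_self K (x j)⟩, ?_⟩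
        rw [Finset.prod_eq_single j]
        · simp
        · intro b _ hb; rw [Pi.mulSingle_eq_of_ne hb]; rfl
        · simp
      | one => exact ⟨1, by simp⟩
      | mul a b _ _ ha hb =>
        obtain ⟨γ, rfl⟩ := ha
        obtain ⟨δ, rfl⟩ := hb
        exact ⟨γ * δ, by simp [Finset.prod_mul_distrib]⟩
  obtain ⟨f, rfl⟩ := this
  exact ⟨PiTensorProduct.tprod K f, modularMulMap_tprod x f⟩

lemma Box.isModular [FiniteDimensional K L] {p n : ℕ} (hp : 0 < p) {x : Fin n → L}
    {ε : Fin n → ℕ} (h : Box K L p x ε) : IsModular K L := by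
  refine ⟨n, x, ?_⟩
  have hs := mulMap_surj x h.top
  have hle : Module.finrank K (⨂[K] i, ↥(IntermediateField.adjoin K {x i})) ≤ Module.finrank K L := by
    rw [finrank_pi, h.rank]
    refine Finset.prod_le_prod' fun i _ => ?_
    rw [IntermediateField.adjoin.finrank (Algebra.IsIntegral.isIntegral (x i))]
    obtain ⟨a, ha⟩ := h.mem i
    have hne : (Polynomial.X ^ p ^ ε i - Polynomial.C a).Monic :=
      Polynomial.monic_X_pow_sub_C a (by positivity)
    refine (Polynomial.natDegree_le_natDegree (minpoly.min K (x i) hne (by simp [ha]))).trans ?_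
    rw [Polynomial.natDegree_X_pow_sub_C]
  have : Module.Finite K (⨂[K] i, ↥(IntermediateField.adjoin K {x i})) := inferInstance
  have heq := le_antisymm hle (LinearMap.finrank_le_finrank_of_surjective hs)
  exact ⟨(LinearMap.injective_iff_surjective_of_finrank_eq_finrank heq).2 hs, hs⟩

lemma exists_box_of_isModular [FiniteDimensional K L] (p : ℕ) (hp : p.Prime) [CharP K p]
    (hins : ∀ y : L, ∃ m : ℕ, y ^ p ^ m ∈ (algebraMap K L).range) (h : IsModular K L) :
    ∃ (n : ℕ) (x : Fin n → L) (ε : Fin n → ℕ), Box K L p x ε := by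
  obtain ⟨n, x, hb⟩ := h
  have : ExpChar K p := ExpChar.prime hp
  have : IsPurelyInseparable K L := (isPurelyInseparable_iff_pow_mem K p).2 hins
  have hm := fun j => IsPurelyInseparable.minpoly_eq_X_pow_sub_C K p (x j)
  choose ε a hε using hm
  refine ⟨n, x, ε, ?_, ?_, ?_⟩
  · intro j
    refine ⟨a j, ?_⟩
    have := minpoly.aeval K (x j)
    rw [hε] at this
    simp [sub_eq_zero] at this
    exact this.symm
  · rw [eq_top_iff]
    intro z _
    obtain ⟨t, rfl⟩ := hb.2 z
    induction t using PiTensorProduct.induction_on with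
    | smul_tprod r f =>
      rw [map_smul, modularMulMap_tprod]
      refine IntermediateField.smul_mem _ (prod_mem fun i _ => ?_)
      exact IntermediateField.adjoin.mono K _ _ (by simp) (f i).2
    | add a b ha hb => rw [map_add]; exact add_mem (ha trivial) (hb trivial)
  · rw [← (LinearEquiv.ofBijective _ hb).finrank_eq, finrank_pi]
    refine Finset.prod_congr rfl fun i _ => ?_
    rw [IntermediateField.adjoin.finrank (Algebra.IsIntegral.isIntegral (x i)), hε]
    exact Polynomial.natDegree_X_pow_sub_C

end Mono
end ModDiff

namespace ModDiff

section Hasse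
set_option linter.unusedSectionVars false
variable {K L : Type*} [Field K] [Field L] [Algebra K L]

lemma choose_add_pow (p : ℕ) (hp : p.Prime) [CharP L p] (ε k m : ℕ) (hk : k < p ^ ε) :
    ((Nat.choose (m + p ^ ε) k : ℕ) : L) = (Nat.choose m k : ℕ) := by
  rw [Nat.add_choose_eq, Nat.cast_sum, Finset.sum_eq_single (k, 0)]
  · simp
  · rintro ⟨a, b⟩ hab hne
    have hb : b ≠ 0 := by
      rintro rfl
      simp at hab; exact hne (by simp [hab])
    have hab' : a + b = k := by simpa using hab
    have : p ∣ (p ^ ε).choose b := hp.dvd_choose_pow hb (by omega)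
    rw [Nat.cast_mul, (CharP.cast_eq_zero_iff L p _).2 this, mul_zero]
  · simp

lemma choose_mod_pow (p : ℕ) (hp : p.Prime) [CharP L p] (ε k m : ℕ) (hk : k < p ^ ε) :
    ((Nat.choose m k : ℕ) : L) = (Nat.choose (m % p ^ ε) k : ℕ) := by
  conv_lhs => rw [← Nat.mod_add_div m (p ^ ε)]
  generalize m % p ^ ε = r
  induction m / p ^ ε with
  | zero => simp
  | succ t ih => rw [mul_add, mul_one, ← add_assoc, choose_add_pow p hp ε k _ hk, ih]

lemma one_var_red (p : ℕ) (hp : p.Prime) [CharP L p] (ε k m : ℕ) (hk : k < p ^ ε) (x : L) :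
    ((Nat.choose m k : ℕ) : L) * x ^ (m - k)
      = x ^ (p ^ ε * (m / p ^ ε)) * (((Nat.choose (m % p ^ ε) k : ℕ) : L) * x ^ (m % p ^ ε - k)) := by
  rw [choose_mod_pow p hp ε k m hk]
  by_cases h : k ≤ m % p ^ ε
  · have : m - k = p ^ ε * (m / p ^ ε) + (m % p ^ ε - k) := by
      have := Nat.mod_add_div m (p ^ ε); omega
    rw [this, pow_add]; ring
  · rw [Nat.choose_eq_zero_of_lt (by omega)]; simp

lemma one_var_adc (b a : ℕ) (x : L) :
    ((Nat.choose (b + 1) a : ℕ) : L) * x ^ (b + 1 - a) - x * (((Nat.choose b a : ℕ) : L) * x ^ (b - a))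
      = if a = 0 then 0 else ((Nat.choose b (a - 1) : ℕ) : L) * x ^ (b - (a - 1)) := by
  cases a with
  | zero => simp [pow_succ']
  | succ a =>
    simp only [Nat.add_sub_cancel, Nat.succ_ne_zero, if_false]
    rw [Nat.choose_succ_succ, Nat.add_sub_add_right]
    by_cases h : a + 1 ≤ b
    · have : b - a = (b - (a + 1)) + 1 := by omega
      rw [this, pow_succ]; push_cast; ring
    · rw [Nat.choose_eq_zero_of_lt (show b < a.succ by omega)]; simp

variable [FiniteDimensional K L] {p n : ℕ} (hp : p.Prime) {x : Fin n → L}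
    {ε : Fin n → ℕ} (h : Box K L p x ε)

/-- Hasse derivatives -/
noncomputable def hasse (α : Fin n → ℕ) : L →ₗ[K] L :=
  (h.basis hp.pos).constr K (fun β => ∏ j, ((Nat.choose (β j) (α j) : ℕ) : L) * x j ^ ((β j : ℕ) - α j))

lemma hasse_mono [CharP L p] (α : Fin n → ℕ) (hα : ∀ j, α j < p ^ ε j) (γ : Fin n → ℕ) :
    hasse hp h α (mono x γ) = ∏ j, ((Nat.choose (γ j) (α j) : ℕ) : L) * x j ^ (γ j - α j) := by
  choose a ha using h.mem
  rw [mono_reduce x _ a (fun j => (ha j).symm), map_smul]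
  have : mono x (fun j => γ j % p ^ ε j) = h.basis hp.pos
      (fun j => ⟨γ j % p ^ ε j, Nat.mod_lt _ (pow_pos hp.pos _)⟩) := by
    rw [Box.basis_apply]
  rw [this, hasse, Module.Basis.constr_basis, Algebra.smul_def, map_prod, ← Finset.prod_mul_distrib]
  refine Finset.prod_congr rfl fun j _ => ?_
  rw [one_var_red p hp (ε j) (α j) (γ j) (hα j), map_pow, ha, ← pow_mul]

lemma mul_mono (x : Fin n → L) (i : Fin n) (γ : Fin n → ℕ) :
    x i * mono x γ = mono x (Function.update γ i (γ i + 1)) := by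
  rw [mono, mono, ← Finset.mul_prod_erase _ _ (Finset.mem_univ i),
    ← Finset.mul_prod_erase _ _ (Finset.mem_univ i), ← mul_assoc]
  simp only [Function.update_self]
  rw [pow_succ']
  congr 1
  refine Finset.prod_congr rfl fun j hj => ?_
  rw [Function.update_of_ne (Finset.ne_of_mem_erase hj)]

lemma update_lt {q α : Fin n → ℕ} (hα : ∀ j, α j < q j) (i : Fin n) :
    ∀ j, Function.update α i (α i - 1) j < q j := by
  intro j
  by_cases hj : j = i
  · subst hj; rw [Function.update_self]; have := hα j; omega
  · rw [Function.update_of_ne hj]; exact hα j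

lemma adc_hasse [CharP L p] (α : Fin n → ℕ) (hα : ∀ j, α j < p ^ ε j) (i : Fin n) :
    adc (hasse hp h α) (x i) = if α i = 0 then 0 else
      hasse hp h (Function.update α i (α i - 1)) := by
  refine (h.basis hp.pos).ext fun β => ?_
  rw [Box.basis_apply]
  generalize hγ : (fun j => ((β j : ℕ))) = γ
  have key : (if α i = 0 then 0 else hasse hp h (Function.update α i (α i - 1))) (mono x γ)
     = (if α i = 0 then 0 else hasse hp h (Function.update α i (α i - 1)) (mono x γ)) := by
    split_ifs <;> rfl
  rw [key, adc_apply, mul_mono, hasse_mono hp h α hα, hasse_mono hp h α hα,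
    hasse_mono hp h _ (update_lt hα i)]
  rw [← Finset.mul_prod_erase _ _ (Finset.mem_univ i),
    ← Finset.mul_prod_erase _ _ (Finset.mem_univ i), ← Finset.mul_prod_erase _ _ (Finset.mem_univ i)]
  simp only [Function.update_self]
  have e1 : ∀ f : ℕ → ℕ → L → L, ∏ j ∈ Finset.univ.erase i, f (Function.update γ i (γ i + 1) j) (α j) (x j)
      = ∏ j ∈ Finset.univ.erase i, f (γ j) (α j) (x j) := by
    intro f
    refine Finset.prod_congr rfl fun j hj => ?_
    rw [Function.update_of_ne (Finset.ne_of_mem_erase hj)]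
  have e2 : ∀ f : ℕ → ℕ → L → L, ∏ j ∈ Finset.univ.erase i, f (γ j) (Function.update α i (α i - 1) j) (x j)
      = ∏ j ∈ Finset.univ.erase i, f (γ j) (α j) (x j) := by
    intro f
    refine Finset.prod_congr rfl fun j hj => ?_
    rw [Function.update_of_ne (Finset.ne_of_mem_erase hj)]
  rw [e1 (fun a b c => ((Nat.choose a b : ℕ) : L) * c ^ (a - b)),
    e2 (fun a b c => ((Nat.choose a b : ℕ) : L) * c ^ (a - b)), ← mul_assoc, ← sub_mul, one_var_adc]
  split_ifs <;> simp

lemma box_closure (hp : p.Prime) (h : Box K L p x ε) : Subring.closure (Set.range (algebraMap K L) ∪ Set.range x) = ⊤ := by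
  rw [eq_top_iff]
  intro z hz0
  clear hz0
  have hz : z ∈ Submodule.span K _ := h.span hp.pos trivial
  induction hz using Submodule.span_induction with
  | mem z hz =>
    obtain ⟨β, rfl⟩ := hz
    have hj : ∀ j, x j ∈ Subring.closure (Set.range (algebraMap K L) ∪ Set.range x) :=
      fun j => Subring.subset_closure (Or.inr ⟨j, rfl⟩)
    change (∏ j, x j ^ (β j : ℕ)) ∈ _
    exact Subring.prod_mem _ fun j _ => Subring.pow_mem _ (hj j) _
  | zero => exact zero_mem _
  | add a b _ _ ha hb => exact add_mem ha hb
  | smul c a _ ha =>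
    rw [Algebra.smul_def]
    exact mul_mem (Subring.subset_closure (Or.inl ⟨c, rfl⟩)) ha

lemma adc_algebraMap (D : L →ₗ[K] L) (c : K) : adc D (algebraMap K L c) = 0 := by
  ext y; rw [adc_apply, ← Algebra.smul_def, ← Algebra.smul_def, map_smul]; simp

lemma hasse_zero [CharP L p] : hasse hp h 0 = LinearMap.id := by
  refine (h.basis hp.pos).ext fun β => ?_
  rw [Box.basis_apply, hasse_mono hp h 0 (fun j => pow_pos hp.pos _)]
  simp [mono]

lemma isDiff_hasse [CharP L p] (m : ℕ) (α : Fin n → ℕ) (hα : ∀ j, α j < p ^ ε j)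
    (hm : ∑ j, α j ≤ m) : IsDiffOpLE K L m (hasse hp h α) := by
  induction m generalizing α with
  | zero =>
    have : α = 0 := by
      ext j; have := Finset.single_le_sum (f := α) (fun _ _ => Nat.zero_le _) (Finset.mem_univ j)
      simp; omega
    rw [this, hasse_zero]
    exact isDiff_id 0
  | succ m ih =>
    refine isDiff_of_gen m _ _ ?_ (box_closure hp h)
    rintro _ (⟨c, rfl⟩ | ⟨i, rfl⟩)
    · rw [adc_algebraMap]; exact isDiff_zero_map m
    · rw [adc_hasse hp h α hα]
      split_ifs with h0
      · exact isDiff_zero_map m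
      · refine ih _ (update_lt hα i) ?_
        rw [Finset.sum_update_of_mem (Finset.mem_univ i)]
        rw [← Finset.add_sum_erase _ _ (Finset.mem_univ i)] at hm
        rw [← Finset.erase_eq]
        omega

/-- iterated commutator with the generators, evaluated at `1` -/
noncomputable def coef (x : Fin n → L) (l : List (Fin n)) (D : L →ₗ[K] L) : L :=
  (l.map x).foldl adc D 1

lemma coef_hasse [CharP L p] (l : List (Fin n)) (α : Fin n → ℕ) (hα : ∀ j, α j < p ^ ε j) :
    coef x l (hasse hp h α) = if (∀ j, l.count j = α j) then 1 else 0 := by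
  induction l generalizing α with
  | nil =>
    have : (1 : L) = mono x 0 := by simp [mono]
    have e1 := hasse_mono hp h α hα 0
    rw [← this] at e1
    rw [coef, List.map_nil, List.foldl_nil, e1]
    by_cases h0 : ∀ j, List.count j [] = α j
    · rw [if_pos h0]
      simp only [List.count_nil] at h0
      simp [← h0]
    · rw [if_neg h0]
      simp only [List.count_nil] at h0
      push Not at h0
      obtain ⟨j, hj⟩ := h0
      refine Finset.prod_eq_zero (M₀ := L) (Finset.mem_univ j) ?_
      rw [Nat.choose_eq_zero_of_lt (by simp; omega)]; simp
  | cons i l ih =>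
    rw [coef, List.map_cons, List.foldl_cons, adc_hasse hp h α hα]
    by_cases h0 : α i = 0
    · rw [if_pos h0, foldl_adc_zero, if_neg]
      · rfl
      · intro hc; have := hc i; simp at this; omega
    · rw [if_neg h0]
      have := ih (Function.update α i (α i - 1)) (update_lt hα i)
      rw [coef] at this
      rw [this]
      congr 1
      rw [eq_iff_iff]
      refine forall_congr' fun j => ?_
      by_cases hj : j = i
      · subst hj; simp; omega
      · rw [Function.update_of_ne hj, List.count_cons_of_ne (Ne.symm hj)]

lemma coef_add (l : List (Fin n)) (D E : L →ₗ[K] L) : coef x l (D + E) = coef x l D + coef x l E := by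
  induction l generalizing D E with
  | nil => simp [coef]
  | cons i l ih =>
    have : adc (D + E) (x i) = adc D (x i) + adc E (x i) := by ext; simp; ring
    have := ih (adc D (x i)) (adc E (x i))
    simp_all [coef]

lemma coef_smul (l : List (Fin n)) (c : L) (D : L →ₗ[K] L) : coef x l (c • D) = c * coef x l D := by
  induction l generalizing D with
  | nil => simp [coef]
  | cons i l ih =>
    have : adc (c • D) (x i) = c • adc D (x i) := by ext; simp; ring
    have := ih (adc D (x i))
    simp_all [coef]

/-- `coef` as a linear map -/
noncomputable def coefL (x : Fin n → L) (l : List (Fin n)) : (L →ₗ[K] L) →ₗ[L] L where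
  toFun := coef x l
  map_add' := coef_add l
  map_smul' := coef_smul l

lemma exists_list (β : Fin n → ℕ) : ∃ l : List (Fin n), (∀ j, l.count j = β j) ∧ l.length = ∑ j, β j := by
  obtain ⟨l, hl⟩ : ∃ l : List (Fin n), (l : Multiset (Fin n)) = ∑ j, Multiset.replicate (β j) j :=
    ⟨_, Multiset.coe_toList _⟩
  have h1 : ∀ j, l.count j = β j := by
    intro j
    rw [← Multiset.coe_count]
    rw [hl, Multiset.count_sum', Finset.sum_eq_single j] 
    · simp
    · intro b _ hb; rw [Multiset.count_replicate, if_neg hb]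
    · simp
  refine ⟨l, h1, ?_⟩
  rw [← Multiset.coe_card]
  rw [hl]; simp

lemma isDiff_mem_span [CharP L p] (m : ℕ) (D : L →ₗ[K] L) (hD : IsDiffOpLE K L m D) :
    D ∈ Submodule.span L {E | ∃ α : Fin n → ℕ, (∀ j, α j < p ^ ε j) ∧ ∑ j, α j ≤ m ∧
      E = hasse hp h α} := by
  classical
  choose l hl hlen using fun β : Fin n → ℕ => exists_list β
  let v : ((j : Fin n) → Fin (p ^ ε j)) → (L →ₗ[K] L) := fun α => hasse hp h (fun j => α j)
  have hdual : ∀ α β : (j : Fin n) → Fin (p ^ ε j), coefL x (l fun j => β j) (v α)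
      = if α = β then 1 else 0 := by
    intro α β
    change coef x _ _ = _
    rw [coef_hasse hp h _ _ (fun j => (α j).2)]
    congr 1
    rw [eq_iff_iff]
    constructor
    · intro hh; ext j; have := hh j; rw [hl] at this; exact this.symm
    · rintro rfl j; rw [hl]
  have hcoef : ∀ (c : ((j : Fin n) → Fin (p ^ ε j)) → L) β,
      coefL x (l fun j => β j) (∑ α, c α • v α) = c β := by
    intro c β
    rw [map_sum, Finset.sum_eq_single β]
    · rw [map_smul, hdual]; simp
    · intro b _ hb; rw [map_smul, hdual, if_neg hb]; simp
    · simp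
  have hli : LinearIndependent L v := by
    rw [Fintype.linearIndependent_iff]
    intro c hc β
    rw [← hcoef c β, hc, map_zero]
  have hspan : ⊤ ≤ Submodule.span L (Set.range v) := by
    refine (hli.span_eq_top_of_card_eq_finrank' ?_).ge
    rw [Module.finrank_linearMap_self, h.rank]
    simp
  obtain ⟨c, hc⟩ := (Submodule.mem_span_range_iff_exists_fun L).1 (hspan (x := D) trivial)
  rw [← hc]
  refine Submodule.sum_mem _ fun β _ => ?_
  by_cases hβ : ∑ j, (β j : ℕ) ≤ m
  · exact Submodule.smul_mem _ _ (Submodule.subset_span ⟨_, fun j => (β j).2, hβ, rfl⟩)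
  · have : c β = 0 := by
      rw [← hcoef c β, hc]
      change (List.map x _).foldl adc D 1 = 0
      rw [isDiff_list m D hD]
      · rfl
      · simp [hlen]; omega
    rw [this, zero_smul]; exact zero_mem _

lemma p_dvd_choose (hp : p.Prime) (i b a : ℕ) (ha : ¬ p ^ i ∣ a) : p ∣ (p ^ i * b).choose a := by
  by_contra hcon
  apply ha
  have hcop : Nat.Coprime (p ^ i) ((p ^ i * b).choose a) :=
    Nat.Coprime.pow_left _ ((Nat.Prime.coprime_iff_not_dvd hp).2 hcon)
  cases a with
  | zero => simp
  | succ a =>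
    by_cases hb : p ^ i * b = 0
    · rw [hb] at hcon; simp at hcon
    · obtain ⟨N, hN⟩ := Nat.exists_eq_succ_of_ne_zero hb
      have := Nat.add_one_mul_choose_eq N a
      refine hcop.dvd_of_dvd_mul_left ?_
      rw [hN, Nat.succ_eq_add_one, ← this, ← Nat.succ_eq_add_one, ← hN, mul_assoc]
      exact dvd_mul_right _ _

lemma hasse_pow [CharP L p] (α : Fin n → ℕ) (hα : ∀ j, α j < p ^ ε j) (i : ℕ) (y : L) :
    ∃ z, hasse hp h α (y ^ p ^ i) = z ^ p ^ i := by
  have := Fact.mk hp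
  have hy : y ∈ Submodule.span K _ := h.span hp.pos trivial
  induction hy using Submodule.span_induction with
  | mem y hy =>
    obtain ⟨β, rfl⟩ := hy
    have : mono x (fun j => (β j : ℕ)) ^ p ^ i = mono x (fun j => p ^ i * (β j : ℕ)) := by
      simp only [mono, ← Finset.prod_pow, ← pow_mul]
      simp only [mul_comm]
    simp only [this]
    rw [hasse_mono hp h α hα]
    have : ∀ j, ∃ z : L, (((p ^ i * (β j : ℕ)).choose (α j) : ℕ) : L) * x j ^ (p ^ i * (β j : ℕ) - α j)
        = z ^ p ^ i := by
      intro j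
      by_cases hd : p ^ i ∣ α j
      · obtain ⟨a, ha⟩ := hd
        refine ⟨(((p ^ i * (β j : ℕ)).choose (α j) : ℕ) : L) * x j ^ ((β j : ℕ) - a), ?_⟩
        rw [mul_pow, ← pow_mul]
        congr 1
        · exact (map_natCast (iterateFrobenius L p i) _).symm
        · rw [ha, ← Nat.mul_sub, mul_comm]
      · refine ⟨0, ?_⟩
        rw [(CharP.cast_eq_zero_iff L p _).2 (p_dvd_choose hp i _ _ hd), zero_mul, zero_pow]
        exact pow_ne_zero _ hp.ne_zero
    choose z hz using this
    exact ⟨∏ j, z j, by rw [← Finset.prod_pow]; exact Finset.prod_congr rfl fun j _ => hz j⟩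
  | zero => exact ⟨0, by rw [zero_pow (pow_ne_zero _ hp.ne_zero), map_zero]⟩
  | add a b _ _ ha hb =>
    obtain ⟨z, hz⟩ := ha
    obtain ⟨w, hw⟩ := hb
    exact ⟨z + w, by rw [add_pow_char_pow, add_pow_char_pow, map_add, hz, hw]⟩
  | smul c a _ ha =>
    obtain ⟨z, hz⟩ := ha
    exact ⟨c • z, by rw [smul_pow, smul_pow, map_smul, hz]⟩

theorem span_of_box [CharP L p] (hp : p.Prime) (h : Box K L p x ε) (i : ℕ) (D : L →ₗ[K] L) (hD : IsDiffOpLE K L (p ^ i) D) :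
    D ∈ Submodule.span L (Adiff K L p i) := by
  refine Submodule.span_mono ?_ (isDiff_mem_span hp h _ D hD)
  rintro _ ⟨α, hα, hm, rfl⟩
  exact ⟨isDiff_hasse hp h _ α hα hm, fun j _ y => hasse_pow hp h α hα j y⟩

end Hasse
end ModDiff

namespace ModDiff

section Sweedler
set_option linter.unusedSectionVars false
variable {K L : Type*} [Field K] [Field L] [Algebra K L]

/-- field generated by a list -/
def adj (K : Type*) {L : Type*} [Field K] [Field L] [Algebra K L] (l : List L) :
    IntermediateField K L := IntermediateField.adjoin K {t | t ∈ l}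

lemma mem_adj {l : List L} {t : L} (h : t ∈ l) : t ∈ adj K l :=
  IntermediateField.subset_adjoin K _ h

lemma adj_le {l : List L} {W : IntermediateField K L} : adj K l ≤ W ↔ ∀ t ∈ l, t ∈ W := by
  rw [adj, IntermediateField.adjoin_le_iff]; rfl

/-- iterated `p`-independence -/
def PI (V : IntermediateField K L) : List L → Prop
  | [] => True
  | t :: l => t ∉ V ⊔ adj K l ∧ PI V l

/-- the field `K(L^{p^m})` -/
def Vm (K L : Type*) [Field K] [Field L] [Algebra K L] (p m : ℕ) : IntermediateField K L :=
  IntermediateField.adjoin K (Set.range fun y : L => y ^ p ^ m)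

lemma mem_Vm (p m : ℕ) (y : L) : y ^ p ^ m ∈ Vm K L p m :=
  IntermediateField.subset_adjoin K _ ⟨y, rfl⟩

lemma Vm_le {p m : ℕ} {W : IntermediateField K L} : Vm K L p m ≤ W ↔ ∀ y : L, y ^ p ^ m ∈ W := by
  rw [Vm, IntermediateField.adjoin_le_iff]
  exact ⟨fun h y => h ⟨y, rfl⟩, by rintro h _ ⟨y, rfl⟩; exact h y⟩

lemma Vm_anti (p : ℕ) {m m' : ℕ} (h : m ≤ m') : Vm K L p m' ≤ Vm K L p m := by
  rw [Vm_le]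
  intro y
  obtain ⟨k, rfl⟩ := Nat.exists_eq_add_of_le h
  rw [pow_add, mul_comm, pow_mul]
  exact mem_Vm p m _

lemma Vm_zero (p : ℕ) : Vm K L p 0 = ⊤ := by
  rw [eq_top_iff]; intro z _; have := mem_Vm (K := K) p 0 z; simpa using this

lemma Vm_bot (p m : ℕ) (h : ∀ y : L, y ^ p ^ m ∈ (algebraMap K L).range) : Vm K L p m = ⊥ := by
  rw [eq_bot_iff, Vm_le]
  intro y
  rw [IntermediateField.mem_bot]
  exact h y

/-- preimage of an intermediate field under the Frobenius -/
def frobPre (p : ℕ) [Fact p.Prime] [CharP L p] (W : IntermediateField K L) :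
    IntermediateField K L :=
  (W.toSubfield.comap (frobenius L p)).toIntermediateField (fun c => by
    change (algebraMap K L c) ^ p ∈ W
    exact pow_mem (W.algebraMap_mem c) p)

lemma mem_frobPre (p : ℕ) [Fact p.Prime] [CharP L p] (W : IntermediateField K L) (z : L) :
    z ∈ frobPre p W ↔ z ^ p ∈ W := Iff.rfl

lemma PI_frob (p : ℕ) [Fact p.Prime] [CharP L p] (V V' : IntermediateField K L)
    (hV : ∀ v ∈ V, v ^ p ∈ V') (l : List L) (h : PI V' (l.map (· ^ p))) : PI V l := by
  induction l with
  | nil => trivial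
  | cons t l ih =>
    refine ⟨fun ht => h.1 ?_, ih h.2⟩
    have : V ⊔ adj K l ≤ frobPre p (V' ⊔ adj K (l.map (· ^ p))) := by
      refine sup_le (fun v hv => ?_) (adj_le.2 fun s hs => ?_)
      · exact (le_sup_left : V' ≤ V' ⊔ _) (hV v hv)
      · exact (le_sup_right : _ ≤ V' ⊔ _) (mem_adj (List.mem_map_of_mem hs))
    exact this ht

lemma adj_cons (t : L) (l : List L) : adj K (t :: l) = IntermediateField.adjoin K {t} ⊔ adj K l := by
  apply le_antisymm
  · rw [adj_le]
    intro s hs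
    rcases List.mem_cons.1 hs with rfl | hs
    · exact (le_sup_left : IntermediateField.adjoin K {s} ≤ _) (IntermediateField.mem_adjoin_simple_self K s)
    · exact (le_sup_right : adj K l ≤ _) (mem_adj hs)
  · refine sup_le ?_ ?_
    · rw [IntermediateField.adjoin_simple_le_iff]; exact mem_adj (by simp)
    · rw [adj_le]; intro s hs; exact mem_adj (by simp [hs])

lemma deg [FiniteDimensional K L] (p : ℕ) [Fact p.Prime] [CharP L p] (W : IntermediateField K L) (t : L)
    (ht : t ^ p ∈ W) (ht' : t ∉ W) :
    Module.finrank K (IntermediateField.adjoin K {t} ⊔ W : IntermediateField K L)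
      = p * Module.finrank K W := by
  have hp : p.Prime := Fact.out
  let a : W := ⟨t ^ p, ht⟩
  have irr : Irreducible (Polynomial.X ^ p - Polynomial.C a) := by
    apply X_pow_sub_C_irreducible_of_prime hp
    intro b hb
    apply ht'
    have : (b : L) ^ p = t ^ p := by
      have := congrArg (algebraMap W L) hb
      simpa using this
    have := frobenius_inj L p this
    rw [← this]; exact b.2
  have hm : minpoly W t = Polynomial.X ^ p - Polynomial.C a := by
    symm
    apply minpoly.eq_of_irreducible_of_monic irr
    · simp [a, IntermediateField.algebraMap_apply]
    · exact Polynomial.monic_X_pow_sub_C _ hp.ne_zero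
  have h1 : Module.finrank W (IntermediateField.adjoin W {t}) = p := by
    rw [IntermediateField.adjoin.finrank (Algebra.IsIntegral.isIntegral t), hm,
      Polynomial.natDegree_X_pow_sub_C]
  have h2 : (IntermediateField.adjoin W {t}).restrictScalars K = IntermediateField.adjoin K {t} ⊔ W := by
    apply le_antisymm
    · rw [IntermediateField.restrictScalars_adjoin, IntermediateField.adjoin_le_iff]
      rintro z (hz | hz)
      · exact (le_sup_right : W ≤ _) hz
      · rw [Set.mem_singleton_iff.1 hz]
        exact (le_sup_left : IntermediateField.adjoin K {t} ≤ _) (IntermediateField.mem_adjoin_simple_self K t)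
    · refine sup_le ?_ ?_
      · rw [IntermediateField.adjoin_simple_le_iff]
        exact IntermediateField.mem_adjoin_simple_self W t
      · intro w hw
        exact (IntermediateField.adjoin W {t}).algebraMap_mem ⟨w, hw⟩
  rw [← h2, ← h1, mul_comm]
  exact (Module.finrank_mul_finrank K W (IntermediateField.adjoin W {t})).symm

lemma PI_finrank [FiniteDimensional K L] (p : ℕ) [Fact p.Prime] [CharP L p] (V : IntermediateField K L) (l : List L)
    (hl : ∀ t ∈ l, t ^ p ∈ V) (h : PI V l) :
    Module.finrank K (V ⊔ adj K l : IntermediateField K L) = p ^ l.length * Module.finrank K V := by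
  induction l with
  | nil =>
    have : adj K ([] : List L) = ⊥ := by rw [eq_bot_iff, adj_le]; simp
    rw [this, sup_eq_left.2 bot_le]; simp
  | cons t l ih =>
    have := ih (fun s hs => hl s (by simp [hs])) h.2
    rw [adj_cons, sup_left_comm, deg p _ t ((le_sup_left : V ≤ _) (hl t (by simp))) h.1, this,
      List.length_cons, pow_succ]
    ring

lemma extend [FiniteDimensional K L] (V : IntermediateField K L) (f : L → L) (U : Set L) (N : ℕ) (ts : List L)
    (hN : Module.finrank K L - Module.finrank K (V ⊔ adj K ts : IntermediateField K L) ≤ N)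
    (h : PI V ts) : ∃ us : List L, (∀ u ∈ us, u ∈ U) ∧ PI V (us.map f ++ ts) ∧
      ∀ u ∈ U, f u ∈ V ⊔ adj K (us.map f ++ ts) := by
  induction N generalizing ts with
  | zero =>
    by_cases hh : ∀ u ∈ U, f u ∈ V ⊔ adj K ts
    · exact ⟨[], by simp, by simpa using h, by simpa using hh⟩
    · push Not at hh
      obtain ⟨u, hu, hfu⟩ := hh
      exfalso
      apply hfu
      have : V ⊔ adj K ts = ⊤ := by
        apply IntermediateField.eq_of_le_of_finrank_le le_top
        rw [IntermediateField.finrank_top']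
        omega
      rw [this]; trivial
  | succ N ih =>
    by_cases hh : ∀ u ∈ U, f u ∈ V ⊔ adj K ts
    · exact ⟨[], by simp, by simpa using h, by simpa using hh⟩
    · push Not at hh
      obtain ⟨u, hu, hfu⟩ := hh
      have hlt : V ⊔ adj K ts < V ⊔ adj K (f u :: ts) := by
        refine lt_of_le_of_ne (sup_le_sup_left ?_ _) ?_
        · rw [adj_cons]; exact le_sup_right
        · intro heq; apply hfu; rw [heq]
          exact (le_sup_right : adj K (f u :: ts) ≤ _) (mem_adj (by simp))
      have hlt' : Module.finrank K (V ⊔ adj K ts : IntermediateField K L) <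
          Module.finrank K (V ⊔ adj K (f u :: ts) : IntermediateField K L) :=
        Submodule.finrank_lt_finrank_of_lt
          (s := (V ⊔ adj K ts).toSubalgebra.toSubmodule)
          (t := (V ⊔ adj K (f u :: ts)).toSubalgebra.toSubmodule) hlt
      obtain ⟨us, h1, h2, h3⟩ := ih (f u :: ts) (by omega) ⟨hfu, h⟩
      refine ⟨us ++ [u], ?_, ?_, ?_⟩
      · intro v hv
        rcases List.mem_append.1 hv with hv | hv
        · exact h1 v hv
        · rw [List.mem_singleton.1 hv]; exact hu
      · simpa using h2
      · simpa using h3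

/-- the inductive hypothesis in the construction of Sweedler -/
def RR (K L : Type*) [Field K] [Field L] [Algebra K L] (p m : ℕ) : Prop :=
  ∃ l : List (L × ℕ), (∀ a ∈ l, a.1 ^ p ^ (m + a.2) ∈ (algebraMap K L).range) ∧
    Vm K L p m = adj K (l.map fun a => a.1 ^ p ^ m) ∧
    Module.finrank K (Vm K L p m) = p ^ (l.map Prod.snd).sum ∧
    PI (Vm K L p (m + 1)) (l.map fun a => a.1 ^ p ^ m)

/-- the linear disjointness condition -/
def HLD (K L : Type*) [Field K] [Field L] [Algebra K L] (p m : ℕ) : Prop :=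
  ∀ (ι : Type) [Fintype ι] (y : ι → L) (c : ι → K), LinearIndependent K (fun i => y i ^ p ^ m) →
    ∀ z : L, z ^ p ^ m = ∑ i, c i • y i ^ p ^ m → ∀ i, ∃ u : L, algebraMap K L (c i) = u ^ p ^ m

lemma prod_pow_get (p : ℕ) (l : List (L × ℕ)) :
    ∏ j : Fin l.length, p ^ (l.get j).2 = p ^ (l.map Prod.snd).sum := by
  rw [Finset.prod_pow_eq_pow_sum]
  congr 1
  rw [← List.sum_ofFn]
  congr 1
  exact List.ext_get (by simp) (by simp)

lemma adj_get (l : List (L × ℕ)) (f : L → L) :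
    adj K (l.map fun a => f a.1) = IntermediateField.adjoin K (Set.range fun j => f (l.get j).1) := by
  rw [adj]
  congr 1
  ext t
  simp only [List.mem_map, Set.mem_ofPred_eq, Set.mem_range]
  constructor
  · rintro ⟨a, ha, rfl⟩
    obtain ⟨j, rfl⟩ := List.get_of_mem ha
    exact ⟨j, rfl⟩
  · rintro ⟨j, rfl⟩
    exact ⟨_, List.get_mem l j, rfl⟩

lemma expand [FiniteDimensional K L] (p : ℕ) [Fact p.Prime] [CharP L p] (m : ℕ)
    (hLD : HLD K L p m) (l : List (L × ℕ))
    (h1 : ∀ a ∈ l, a.1 ^ p ^ (m + a.2) ∈ (algebraMap K L).range)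
    (h2 : Vm K L p m = adj K (l.map fun a => a.1 ^ p ^ m))
    (h3 : Module.finrank K (Vm K L p m) = p ^ (l.map Prod.snd).sum) (z : L) :
    ∃ (u : ((j : Fin l.length) → Fin (p ^ (l.get j).2)) → L),
      (∀ β, u β ^ p ^ m ∈ (algebraMap K L).range) ∧
      z = ∑ β, u β * mono (fun j => (l.get j).1) (fun j => (β j : ℕ)) := by
  have hp : p.Prime := Fact.out
  set s : Fin l.length → L := fun j => (l.get j).1 with hs
  set q : Fin l.length → ℕ := fun j => p ^ (l.get j).2 with hq
  have hq0 : ∀ j, 0 < q j := fun j => pow_pos hp.pos _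
  have hx : ∀ j, (s j ^ p ^ m) ^ q j ∈ (algebraMap K L).range := by
    intro j
    rw [← pow_mul, ← pow_add]
    exact h1 _ (List.get_mem l j)
  have hadj : Vm K L p m = IntermediateField.adjoin K (Set.range fun j => s j ^ p ^ m) := by
    rw [h2, adj_get l (fun t => t ^ p ^ m)]
  have hr : Module.finrank K (IntermediateField.adjoin K (Set.range fun j => s j ^ p ^ m)) = ∏ j, q j := by
    rw [← hadj, h3, prod_pow_get]
  have hli := mono_linearIndependent (fun j => s j ^ p ^ m) q hq0 hx hr
  have hmono : ∀ β : (j : Fin l.length) → Fin (q j), mono (fun j => s j ^ p ^ m) (fun j => (β j : ℕ))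
      = mono s (fun j => (β j : ℕ)) ^ p ^ m := by
    intro β
    rw [mono, mono, ← Finset.prod_pow]
    refine Finset.prod_congr rfl fun j _ => ?_
    rw [← pow_mul, ← pow_mul, mul_comm]
  have hz := mem_Vm (K := K) p m z
  rw [hadj, adjoin_eq_span _ q hq0 hx] at hz
  rw [Submodule.mem_span_range_iff_exists_fun] at hz
  obtain ⟨c, hc⟩ := hz
  simp only [hmono] at hc hli
  choose u hu using hLD _ _ c hli z hc.symm
  refine ⟨u, fun β => by rw [← hu]; exact ⟨_, rfl⟩, ?_⟩
  apply iterateFrobenius_inj L p m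
  rw [map_sum, iterateFrobenius_def, ← hc]
  refine Finset.sum_congr rfl fun β _ => ?_
  rw [iterateFrobenius_def, mul_pow, ← hu, Algebra.smul_def]

lemma RR_step [FiniteDimensional K L] (p : ℕ) [Fact p.Prime] [CharP L p] (m : ℕ)
    (hLD : (∀ y : L, y ^ p ^ (m + 1) ∈ (algebraMap K L).range) ∨ HLD K L p (m + 1))
    (h : RR K L p (m + 1)) : RR K L p m := by
  have hp : p.Prime := Fact.out
  obtain ⟨l, h1, h2, h3, h4⟩ := h
  have hVp : ∀ m, ∀ v ∈ Vm K L p m, v ^ p ∈ Vm K L p (m + 1) := by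
    intro m v hv
    have : Vm K L p m ≤ frobPre p (Vm K L p (m + 1)) := by
      rw [Vm_le]; intro y; rw [mem_frobPre, ← pow_mul, ← pow_succ]; exact mem_Vm p _ y
    exact this hv
  have hPI : PI (Vm K L p (m + 1)) (l.map fun a => a.1 ^ p ^ m) := by
    refine PI_frob p _ _ (hVp (m + 1)) _ ?_
    convert h4 using 1
    rw [List.map_map]
    refine List.map_congr_left fun a _ => ?_
    simp only [Function.comp]
    rw [← pow_mul, ← pow_succ]
  let U : Set L := {u | u ^ p ^ (m + 1) ∈ (algebraMap K L).range}
  obtain ⟨us, hus, hP, hU⟩ := extend (Vm K L p (m + 1)) (fun u => u ^ p ^ m) U _ _ le_rfl hPI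
  set l' : List (L × ℕ) := us.map (fun u => (u, 1)) ++ l.map (fun a => (a.1, a.2 + 1)) with hl'
  have hmap : (l'.map fun a => a.1 ^ p ^ m) = us.map (fun u => u ^ p ^ m) ++ l.map fun a => a.1 ^ p ^ m := by
    simp [hl', Function.comp_def]
  have hmem : ∀ t ∈ l'.map fun a => a.1 ^ p ^ m, ∃ y : L, t = y ^ p ^ m := by
    intro t ht
    obtain ⟨a, _, rfl⟩ := List.mem_map.1 ht
    exact ⟨_, rfl⟩
  have hmemp : ∀ t ∈ l'.map fun a => a.1 ^ p ^ m, t ^ p ∈ Vm K L p (m + 1) := by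
    intro t ht
    obtain ⟨y, rfl⟩ := hmem t ht
    exact hVp m _ (mem_Vm p m y)
  rw [← hmap] at hP hU
  have hle : Vm K L p (m + 1) ≤ adj K (l'.map fun a => a.1 ^ p ^ m) := by
    rw [h2, adj_le]
    intro t ht
    obtain ⟨a, ha, rfl⟩ := List.mem_map.1 ht
    rw [pow_succ, pow_mul]
    refine pow_mem (mem_adj ?_) p
    rw [hmap]
    exact List.mem_append_right _ (List.mem_map.2 ⟨a, ha, rfl⟩)
  have hW : Vm K L p (m + 1) ⊔ adj K (l'.map fun a => a.1 ^ p ^ m) = adj K (l'.map fun a => a.1 ^ p ^ m) :=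
    sup_eq_right.2 hle
  have hV : Vm K L p m = adj K (l'.map fun a => a.1 ^ p ^ m) := by
    apply le_antisymm
    · rw [hW] at hU
      rw [Vm_le]
      intro z
      rcases hLD with hLD | hLD
      · exact hU z (hLD z)
      · obtain ⟨u, hu, hz⟩ := expand p (m + 1) hLD l h1 h2 h3 z
        rw [hz, ← iterateFrobenius_def, map_sum]
        refine sum_mem fun β _ => ?_
        rw [map_mul]
        refine mul_mem (hU _ (hu β)) ?_
        rw [mono, map_prod]
        refine prod_mem fun j _ => ?_
        rw [map_pow]
        refine pow_mem (mem_adj ?_) _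
        rw [hmap]
        exact List.mem_append_right _ (List.mem_map.2 ⟨_, List.get_mem l j, rfl⟩)
    · rw [adj_le]
      intro t ht
      obtain ⟨y, rfl⟩ := hmem t ht
      exact mem_Vm p m y
  refine ⟨l', ?_, hV, ?_, hP⟩
  · intro a ha
    rcases List.mem_append.1 ha with ha | ha
    · obtain ⟨u, hu, rfl⟩ := List.mem_map.1 ha
      exact hus u hu
    · obtain ⟨b, hb, rfl⟩ := List.mem_map.1 ha
      have := h1 b hb
      rwa [show m + 1 + b.2 = m + (b.2 + 1) by ring] at this
  · rw [hV, ← hW, PI_finrank p _ _ hmemp hP, h3, ← pow_add]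
    congr 1
    have : (l.map (fun a => a.2 + 1)).sum = (l.map Prod.snd).sum + l.length := by
      clear * -
      induction l with
      | nil => rfl
      | cons a l ih => simp [ih]; ring
    simp [hl', Function.comp_def, this]
    ring

lemma sweedler [FiniteDimensional K L] (p : ℕ) [Fact p.Prime] [CharP L p] (e : ℕ)
    (he : ∀ y : L, y ^ p ^ e ∈ (algebraMap K L).range)
    (hLD : ∀ m, m < e → HLD K L p m) :
    ∃ (n : ℕ) (x : Fin n → L) (ε : Fin n → ℕ), Box K L p x ε := by
  have hR : ∀ k ≤ e, RR K L p (e - k) := by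
    intro k
    induction k with
    | zero =>
      intro _
      have hb := Vm_bot p e he
      refine ⟨[], by simp, ?_, ?_, trivial⟩
      · rw [Nat.sub_zero, hb]; symm; rw [eq_bot_iff, adj_le]; simp
      · rw [Nat.sub_zero, hb]; simp
    | succ k ih =>
      intro hk
      have := ih (by omega)
      rw [show e - k = e - (k + 1) + 1 by omega] at this
      refine RR_step p _ ?_ this
      by_cases h0 : k = 0
      · left; rw [show e - (k + 1) + 1 = e by omega]; exact he
      · right; exact hLD _ (by omega)
  obtain ⟨l, h1, h2, h3, _⟩ := hR e le_rfl
  rw [Nat.sub_self] at h1 h2 h3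
  refine ⟨l.length, fun j => (l.get j).1, fun j => (l.get j).2, ?_, ?_, ?_⟩
  · intro j
    have := h1 _ (List.get_mem l j)
    rwa [zero_add] at this
  · rw [Vm_zero, adj_get l (fun t => t ^ p ^ 0)] at h2
    simpa using h2.symm
  · rw [Vm_zero, IntermediateField.finrank_top'] at h3
    rw [h3, prod_pow_get]

end Sweedler
end ModDiff

namespace ModDiff

section Der
set_option linter.unusedSectionVars false

lemma exists_max {K F : Type*} [Field K] [Field F] [Algebra K F] [FiniteDimensional K F]
    (E0 : IntermediateField K F) (y : F) (hy : y ∉ E0) :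
    ∃ E : IntermediateField K F, E0 ≤ E ∧ y ∉ E ∧
      ∀ E' : IntermediateField K F, E < E' → y ∈ E' := by
  have wf := (wellFounded_gt (α := Submodule K F))
  obtain ⟨S, ⟨E, ⟨h1, h2⟩, rfl⟩, hmax⟩ := wf.has_min
    ((fun E : IntermediateField K F => E.toSubalgebra.toSubmodule) '' {E | E0 ≤ E ∧ y ∉ E})
    ⟨_, E0, ⟨le_rfl, hy⟩, rfl⟩
  refine ⟨E, h1, h2, fun E' hE' => ?_⟩
  by_contra hc
  exact hmax _ ⟨E', ⟨h1.trans hE'.le, hc⟩, rfl⟩ hE'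

lemma exists_der {K F : Type*} [Field K] [Field F] [Algebra K F] [FiniteDimensional K F]
    (p : ℕ) [Fact p.Prime] [CharP F p]
    (E0 : IntermediateField K F) (hE0 : ∀ z : F, z ^ p ∈ E0) (y : F) (hy : y ∉ E0) :
    ∃ d : F →ₗ[K] F, (∀ a b, d (a * b) = a * d b + b * d a) ∧ d y ≠ 0 := by
  have hp : p.Prime := Fact.out
  obtain ⟨E, h1, h2, h3⟩ := exists_max E0 y hy
  have hsup : ∀ w : F, w ∉ E → E < IntermediateField.adjoin K {w} ⊔ E := by
    intro w hw
    refine lt_of_le_of_ne le_sup_right fun heq => hw ?_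
    rw [heq]
    exact (le_sup_left : IntermediateField.adjoin K {w} ≤ _) (IntermediateField.mem_adjoin_simple_self K w)
  have htop : IntermediateField.adjoin K {y} ⊔ E = ⊤ := by
    rw [eq_top_iff]
    intro w _
    by_cases hw : w ∈ E
    · exact (le_sup_right : E ≤ _) hw
    · have hyw := h3 _ (hsup w hw)
      have hle : IntermediateField.adjoin K {y} ⊔ E ≤ IntermediateField.adjoin K {w} ⊔ E := by
        refine sup_le ?_ le_sup_right
        rw [IntermediateField.adjoin_simple_le_iff]; exact hyw
      have := IntermediateField.eq_of_le_of_finrank_eq hle (by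
        rw [deg p E y (h1 (hE0 y)) h2, deg p E w (h1 (hE0 w)) hw])
      rw [this]
      exact (le_sup_left : IntermediateField.adjoin K {w} ≤ _) (IntermediateField.mem_adjoin_simple_self K w)
  have hbox : Box E F p (fun _ : Fin 1 => y) (fun _ => 1) := by
    refine ⟨fun j => ?_, ?_, ?_⟩
    · rw [pow_one]; exact ⟨⟨y ^ p, h1 (hE0 y)⟩, rfl⟩
    · rw [eq_top_iff]
      intro w _
      have hw : w ∈ IntermediateField.adjoin K {y} ⊔ E := by rw [htop]; trivial
      have : IntermediateField.adjoin K {y} ⊔ E ≤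
          (IntermediateField.adjoin E (Set.range fun _ : Fin 1 => y)).restrictScalars K := by
        refine sup_le ?_ ?_
        · rw [IntermediateField.adjoin_simple_le_iff]
          exact IntermediateField.subset_adjoin E _ ⟨0, rfl⟩
        · intro w hw
          exact (IntermediateField.adjoin E (Set.range fun _ : Fin 1 => y)).algebraMap_mem ⟨w, hw⟩
      exact this hw
    · have e1 := deg p E y (h1 (hE0 y)) h2
      rw [htop, IntermediateField.finrank_top'] at e1
      have e2 := Module.finrank_mul_finrank K E F
      have e3 : 0 < Module.finrank K E := Module.finrank_pos
      rw [e1, mul_comm] at e2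
      have := Nat.eq_of_mul_eq_mul_right e3 e2
      simp [this]
  have hα : ∀ j : Fin 1, (fun _ : Fin 1 => 1) j < p ^ (fun _ : Fin 1 => 1) j := by
    intro j; simpa using hp.one_lt
  let d := hasse hp hbox (fun _ => 1)
  have hd1 : d 1 = 0 := by
    have := hasse_mono hp hbox (fun _ => 1) hα (fun _ => 0)
    simpa [mono] using this
  have hdy : d y = 1 := by
    have := hasse_mono hp hbox (fun _ => 1) hα (fun _ => 1)
    simpa [mono] using this
  have hdo : IsDiffOpLE E F 1 d := isDiff_hasse hp hbox 1 _ hα (by simp)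
  refine ⟨d.restrictScalars K, ?_, ?_⟩
  · intro a b
    have h := (isDiff_zero _).1 ((isDiff_succ 0 d).1 hdo a) b
    have := LinearMap.congr_fun h 1
    simp [hd1] at this
    simp
    linear_combination this
  · simp [hdy]

lemma isDiff_restrict {K L : Type*} [Field K] [Field L] [Algebra K L] (F : IntermediateField K L)
    (n : ℕ) (D : L →ₗ[F] L) (h : IsDiffOpLE F L n D) : IsDiffOpLE K L n (D.restrictScalars K) := by
  have key : ∀ (D : L →ₗ[F] L) a, adc (D.restrictScalars K) a = (adc D a).restrictScalars K := by
    intro D a; ext y; simp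
  induction n generalizing D with
  | zero =>
    rw [isDiff_zero] at h ⊢
    intro a; rw [key, h]; rfl
  | succ n ih =>
    rw [isDiff_succ] at h ⊢
    intro a; rw [key]; exact ih _ (h a)

lemma exp_le {F L : Type*} [Field F] [Field L] [Algebra F L] [FiniteDimensional F L]
    {p n : ℕ} (hp : p.Prime) {x : Fin n → L} {ε : Fin n → ℕ} (h : Box F L p x ε) (i : ℕ)
    (hF : ∀ y : L, y ^ p ^ i ∈ (algebraMap F L).range) (j : Fin n) : p ^ ε j ≤ p ^ i := by
  classical
  by_contra hc
  push Not at hc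
  obtain ⟨f, hf⟩ := hF (x j)
  let β0 : (j : Fin n) → Fin (p ^ ε j) := fun j => ⟨0, pow_pos hp.pos _⟩
  let β1 : (j : Fin n) → Fin (p ^ ε j) := Function.update β0 j ⟨p ^ i, hc⟩
  have e0 : h.basis hp.pos β0 = 1 := by rw [Box.basis_apply]; simp [mono, β0]
  have e1 : h.basis hp.pos β1 = x j ^ p ^ i := by
    rw [Box.basis_apply, mono, Finset.prod_eq_single j]
    · simp [β1]
    · intro b _ hb; simp [β1, Function.update_of_ne hb, β0]
    · simp
  have hne : β1 ≠ β0 := by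
    intro he
    have := congrFun he j
    simp [β1, β0, Fin.ext_iff] at this
    exact hp.ne_zero this.1
  have e2 : h.basis hp.pos β1 = f • h.basis hp.pos β0 := by
    rw [e0, e1, ← hf, Algebra.smul_def, mul_one]
  have e3 := congrArg (fun z => (h.basis hp.pos).repr z β1) e2
  simp [Finsupp.single_apply, hne.symm] at e3

lemma ext_der {K L : Type*} [Field K] [Field L] [Algebra K L] [FiniteDimensional K L]
    {p n : ℕ} [Fact p.Prime] [CharP L p] (F : IntermediateField K L)
    {x : Fin n → L} {ε : Fin n → ℕ} (h : Box F L p x ε) (i : ℕ)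
    (hF : ∀ y : L, y ^ p ^ i ∈ F) (d : F →ₗ[K] F) (hd : ∀ a b, d (a * b) = a * d b + b * d a) :
    ∃ D : L →ₗ[K] L, IsDiffOpLE K L (p ^ i) D ∧ D 1 = 0 ∧ ∀ f : F, D f = d f := by
  classical
  have hp : p.Prime := Fact.out
  have hF' : ∀ y : L, y ^ p ^ i ∈ (algebraMap F L).range := fun y => ⟨⟨_, hF y⟩, rfl⟩
  set b := h.basis hp.pos with hb
  let D : L →ₗ[K] L := ∑ β, ((LinearMap.toSpanSingleton F L (b β)).restrictScalars K) ∘ₗ d ∘ₗ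
    ((b.coord β).restrictScalars K)
  have hD : ∀ z, D z = ∑ β, d (b.repr z β) • b β := by
    intro z; simp [D]
  have hd1 : d 1 = 0 := by
    have := hd 1 1; simpa using this
  have hsmul : ∀ (f : F) z, D (f • z) = f • D z + d f • z := by
    intro f z
    rw [hD, hD]
    conv_rhs => rw [← b.sum_repr z]
    rw [Finset.smul_sum, Finset.smul_sum, b.sum_repr z, ← Finset.sum_add_distrib]
    refine Finset.sum_congr rfl fun β _ => ?_
    rw [map_smul, Finsupp.smul_apply, smul_eq_mul, hd, add_smul, mul_smul, smul_smul, smul_smul, mul_comm (d f)]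
  have hbasis : ∀ β, D (b β) = 0 := by
    intro β
    rw [hD]
    refine Finset.sum_eq_zero fun γ _ => ?_
    rw [b.repr_self, Finsupp.single_apply]
    split_ifs <;> simp [hd1]
  have hmono : ∀ γ : Fin n → ℕ, (∀ j, γ j < p ^ ε j) → D (mono x γ) = 0 := by
    intro γ hγ
    have := hbasis (fun j => ⟨γ j, hγ j⟩)
    rwa [hb, Box.basis_apply] at this
  have h1 : D 1 = 0 := by
    have := hmono 0 (fun j => pow_pos hp.pos _)
    simpa [mono] using this
  have hex : ∀ f : F, D f = d f := by
    intro f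
    have := hsmul f 1
    rw [h1, smul_zero, zero_add, Algebra.smul_def, Algebra.smul_def, mul_one, mul_one] at this
    exact this
  refine ⟨D, ?_, h1, hex⟩
  choose a ha using h.mem
  let α : Fin n → Fin n → ℕ := fun j => Function.update 0 j (p ^ ε j - 1)
  have hα : ∀ j l, α j l < p ^ ε l := by
    intro j l
    have : 0 < p ^ ε l := pow_pos hp.pos _
    by_cases hl : l = j
    · subst hl; simp [α]; omega
    · simp [α, Function.update_of_ne hl]; omega
  have hcomm : ∀ j, adc D (x j) = ((d (a j) : F) : L) • (hasse hp h (α j)).restrictScalars K := by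
    intro j
    ext z
    have hz : z ∈ Submodule.span F _ := h.span hp.pos trivial
    induction hz using Submodule.span_induction with
    | mem z hz =>
      obtain ⟨β, rfl⟩ := hz
      simp only [adc_apply, LinearMap.smul_apply, LinearMap.restrictScalars_apply]
      rw [hmono _ (fun j => (β j).2), mul_zero, sub_zero, mul_mono, hasse_mono hp h _ (hα j)]
      by_cases hβ : (β j : ℕ) + 1 < p ^ ε j
      · rw [hmono, Finset.prod_eq_zero (Finset.mem_univ j)]
        · simp
        · rw [Nat.choose_eq_zero_of_lt]
          · simp
          · simp [α]; omega
        · intro l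
          by_cases hl : l = j
          · subst hl; simpa using hβ
          · rw [Function.update_of_ne hl]; exact (β l).2
      · have hβ' : (β j : ℕ) + 1 = p ^ ε j := by have := (β j).2; omega
        have e1 : mono x (Function.update (fun j => (β j : ℕ)) j ((β j : ℕ) + 1))
            = a j • mono x (Function.update (fun j => (β j : ℕ)) j 0) := by
          rw [Algebra.smul_def, ha, hβ', mono, mono, ← Finset.mul_prod_erase _ _ (Finset.mem_univ j),
            ← Finset.mul_prod_erase _ _ (Finset.mem_univ j)]
          simp only [Function.update_self, pow_zero, one_mul]
          congr 1
          refine Finset.prod_congr rfl fun l hl => ?_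
          rw [Function.update_of_ne (Finset.ne_of_mem_erase hl), Function.update_of_ne (Finset.ne_of_mem_erase hl)]
        rw [e1, hsmul, hmono, smul_zero, zero_add, Algebra.smul_def, smul_eq_mul]
        · congr 1
          rw [mono]
          refine Finset.prod_congr rfl fun l _ => ?_
          by_cases hl : l = j
          · subst hl
            have : (β l : ℕ) = p ^ ε l - 1 := by omega
            simp [α, this]
          · simp [α, Function.update_of_ne hl]
        · intro l
          by_cases hl : l = j
          · subst hl; simpa using pow_pos hp.pos _
          · rw [Function.update_of_ne hl]; exact (β l).2
    | zero => simp
    | add u v _ _ hu hv => rw [map_add, map_add, hu, hv]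
    | smul c u _ hu =>
      simp only [adc_apply, LinearMap.smul_apply, LinearMap.restrictScalars_apply] at hu ⊢
      rw [mul_smul_comm, hsmul, hsmul, map_smul, smul_comm, ← hu, smul_sub]
      simp only [Algebra.smul_def]
      ring
  have hpi : p ^ i = (p ^ i - 1) + 1 := by have := pow_pos hp.pos i; omega
  rw [hpi]
  refine isDiff_of_gen _ _ _ ?_ (box_closure hp h)
  rintro _ (⟨c, rfl⟩ | ⟨j, rfl⟩)
  · have : adc D (algebraMap F L c) = ((d c : F) : L) • LinearMap.id := by
      ext z
      rw [adc_apply, ← Algebra.smul_def, hsmul, Algebra.smul_def c]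
      simp [Algebra.smul_def]
    rw [this]
    exact isDiff_smul _ _ _ (isDiff_id _)
  · rw [hcomm]
    refine isDiff_smul _ _ _ (isDiff_restrict F _ _ (isDiff_hasse hp h _ _ (hα j) ?_))
    have := exp_le hp h i hF' j
    simp only [α]
    rw [Finset.sum_update_of_mem (Finset.mem_univ j)]
    simp
    omega

end Der
end ModDiff

namespace ModDiff

section LD
set_option linter.unusedSectionVars false
variable {K L : Type*} [Field K] [Field L] [Algebra K L] [FiniteDimensional K L]

lemma lin_Vm (p : ℕ) [Fact p.Prime] [CharP K p] (i : ℕ) (D : L →ₗ[K] L)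
    (hD : IsDiffOpLE K L (p ^ i) D) (u : L) (hu : u ∈ Vm K L p (i + 1)) :
    ∀ g, D (u * g) = u * D g := by
  have hp : p.Prime := Fact.out
  refine IntermediateField.adjoin_induction K (p := fun u _ => ∀ g, D (u * g) = u * D g)
    ?_ ?_ ?_ ?_ ?_ hu
  · rintro _ ⟨y, rfl⟩ g
    exact isDiff_comm_pow p (i + 1) (p ^ i) (Nat.pow_lt_pow_right hp.one_lt (by omega)) D hD y g
  · intro c g
    rw [← Algebra.smul_def, map_smul, Algebra.smul_def]
  · intro a b _ _ ha hb g
    rw [add_mul, map_add, ha, hb, add_mul]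
  · intro a _ ha g
    by_cases h0 : a = 0
    · simp [h0]
    · have := ha (a⁻¹ * g)
      rw [mul_inv_cancel_left₀ h0] at this
      rw [this, inv_mul_cancel_left₀ h0]
  · intro a b _ _ ha hb g
    rw [mul_assoc, ha, hb, mul_assoc]

lemma ld_aux (p i : ℕ) (A : Set (L →ₗ[K] L)) (E k k0 : Subfield L)
    (hk0 : ∀ z, z ∈ E → z ∈ k → z ∈ k0)
    (hlin : ∀ D ∈ A, ∀ u ∈ k, ∀ g, D (u * g) = u * D g)
    (hC : ∀ y, (∀ D ∈ A, D y = y * D 1) → y ∈ k)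
    (hE : ∀ D ∈ A, ∀ g ∈ E, D g ∈ E) (s : Finset L) (hs : ∀ v ∈ s, v ∈ k)
    (hind : LinearIndepOn k0 id (s : Set L)) :
    ∀ g : L → L, (∀ v, g v ∈ E) → ∑ v ∈ s, g v * v = 0 → ∀ v ∈ s, g v = 0 := by
  classical
  induction s using Finset.induction_on with
  | empty => simp
  | insert a s ha ih =>
    have ih' := ih (fun v hv => hs v (Finset.mem_insert_of_mem hv))
      (hind.mono (by intro v hv; exact Finset.mem_coe.2 (Finset.mem_insert_of_mem hv)))
    intro g hg hsum
    rw [Finset.sum_insert ha] at hsum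
    by_cases h0 : g a = 0
    · rw [h0, zero_mul, zero_add] at hsum
      intro v hv
      rcases Finset.mem_insert.1 hv with rfl | hv
      · exact h0
      · exact ih' g hg hsum v hv
    · exfalso
      let h : L → L := fun v => (g a)⁻¹ * g v
      have hh : ∀ v, h v ∈ E := fun v => mul_mem (inv_mem (hg a)) (hg v)
      have hha : h a = 1 := inv_mul_cancel₀ h0
      have hsum' : a + ∑ v ∈ s, h v * v = 0 := by
        have := congrArg (fun z => (g a)⁻¹ * z) hsum
        simp only [mul_add, mul_zero, inv_mul_cancel_left₀ h0, Finset.mul_sum] at this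
        rw [← this]
        congr 1
        exact Finset.sum_congr rfl fun v _ => by simp only [h]; ring
      have hDh : ∀ D ∈ A, ∀ v ∈ s, D (h v) = h v * D 1 := by
        intro D hD v hv
        have e1 := congrArg D hsum'
        rw [map_add, map_sum, map_zero] at e1
        have e2 : D a = a * D 1 := by
          have := hlin D hD a (hs a (Finset.mem_insert_self _ _)) 1
          rwa [mul_one] at this
        have e3 : ∑ v ∈ s, D (h v * v) = ∑ v ∈ s, D (h v) * v := by
          refine Finset.sum_congr rfl fun v hv => ?_
          rw [mul_comm, hlin D hD v (hs v (Finset.mem_insert_of_mem hv)), mul_comm]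
        rw [e2, e3] at e1
        have e4 : ∑ v ∈ s, (D (h v) - h v * D 1) * v = 0 := by
          simp only [sub_mul, Finset.sum_sub_distrib]
          have e5 : ∑ v ∈ s, h v * D 1 * v = (∑ v ∈ s, h v * v) * D 1 := by
            rw [Finset.sum_mul]
            exact Finset.sum_congr rfl fun v _ => by ring
          rw [e5]
          linear_combination e1 - D 1 * hsum'
        have := ih' (fun v => D (h v) - h v * D 1)
          (fun v => sub_mem (hE D hD _ (hh v)) (mul_mem (hh v) (hE D hD _ (one_mem E)))) e4 v hv
        exact sub_eq_zero.1 this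
      have hk : ∀ v ∈ insert a s, h v ∈ k0 := by
        intro v hv
        refine hk0 _ (hh v) ?_
        rcases Finset.mem_insert.1 hv with rfl | hv
        · rw [hha]; exact one_mem _
        · exact hC _ fun D hD => hDh D hD v hv
      rw [linearIndepOn_finset_iff] at hind
      have := hind (fun v => if hv : h v ∈ k0 then ⟨h v, hv⟩ else 0) (by
        rw [← hsum', Finset.sum_insert ha]
        congr 1
        · rw [dif_pos (hk a (Finset.mem_insert_self _ _)), Subfield.smul_def]
          simp [hha]
        · refine Finset.sum_congr rfl fun v hv => ?_
          rw [dif_pos (hk v (Finset.mem_insert_of_mem hv)), Subfield.smul_def]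
          simp) a (Finset.mem_insert_self _ _)
      rw [dif_pos (hk a (Finset.mem_insert_self _ _))] at this
      have := congrArg Subtype.val this
      simp [hha] at this

lemma hld_of (p i m : ℕ) (hm : m ≤ i) [Fact p.Prime] [CharP K p] [CharP L p]
    (hA : ∀ D : L →ₗ[K] L, IsDiffOpLE K L (p ^ i) D → D ∈ Submodule.span L (Adiff K L p i))
    (hC : ∀ y : L, (∀ D : L →ₗ[K] L, IsDiffOpLE K L (p ^ i) D → D y = y * D 1) →
      y ∈ Vm K L p (i + 1)) :
    HLD (Vm K L p (i + 1)) L p m := by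
  classical
  intro ι _ y c hli z hz
  let E : Subfield L := (iterateFrobenius L p m).fieldRange
  let k : Subfield L := (Vm K L p (i + 1)).toSubfield
  let k0 : Subfield L := E ⊓ k
  have hmemE : ∀ y : L, y ^ p ^ m ∈ E := fun y => ⟨y, rfl⟩
  have ld := ld_aux p i (Adiff K L p i) E k k0 (fun z h1 h2 => ⟨h1, h2⟩)
    (fun D hD u hu => lin_Vm p i D hD.1 u hu)
    (by
      intro y hy
      refine hC y fun D hD => ?_
      have hspan := hA D hD
      clear hD
      induction hspan using Submodule.span_induction with
      | mem D hD => exact hy D hD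
      | zero => simp
      | add D D' _ _ h1 h2 => rw [LinearMap.add_apply, LinearMap.add_apply, h1, h2, mul_add]
      | smul a D _ h1 => rw [LinearMap.smul_apply, LinearMap.smul_apply, h1, smul_eq_mul, smul_eq_mul]; ring)
    (by
      rintro D hD _ ⟨y, rfl⟩
      obtain ⟨z, hz⟩ := hD.2 m hm y
      exact ⟨z, hz.symm⟩)
  have h1 : LinearIndepOn k0 id ({1} : Set L) := by
    simp [linearIndepOn_singleton_iff]
  obtain ⟨b, hbt, h1b, htb, hbi⟩ := exists_linearIndepOn_id_extension h1
    (show ({1} : Set L) ⊆ insert 1 (Set.range fun i => (c i : L)) by simp)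
  have hbfin : b.Finite := ((Set.finite_range _).insert 1).subset hbt
  obtain ⟨b, rfl⟩ := hbfin.exists_finset_coe
  have hbk : ∀ v ∈ b, v ∈ k := by
    intro v hv
    rcases hbt hv with rfl | ⟨i, rfl⟩
    · exact one_mem k
    · exact (c i).2
  have hex : ∀ i, ∃ f : L → k0, ∑ v ∈ b, f v • v = (c i : L) := by
    intro i
    have := htb (Set.mem_insert_of_mem _ ⟨i, rfl⟩)
    rw [SetLike.mem_coe, Submodule.mem_span_finset] at this
    obtain ⟨f, _, hf⟩ := this
    exact ⟨f, hf⟩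
  choose φ hφ using hex
  have h1b' : (1 : L) ∈ b := h1b rfl
  have hzero := ld b hbk hbi
    (fun v => ∑ i, (φ i v : L) * y i ^ p ^ m - if v = 1 then z ^ p ^ m else 0)
    (by
      intro v
      refine sub_mem (sum_mem fun i _ => mul_mem (φ i v).2.1 (hmemE _)) ?_
      split_ifs
      · exact hmemE _
      · exact zero_mem _)
    (by
      simp only [sub_mul, Finset.sum_sub_distrib, ite_mul, zero_mul, Finset.sum_ite_eq', h1b', if_true, mul_one]
      rw [hz, sub_eq_zero]
      simp only [Finset.sum_mul]
      rw [Finset.sum_comm]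
      refine Finset.sum_congr rfl fun i _ => ?_
      rw [Algebra.smul_def, IntermediateField.algebraMap_apply, ← hφ i, Finset.sum_mul]
      refine Finset.sum_congr rfl fun v _ => ?_
      rw [Subfield.smul_def, smul_eq_mul]; ring)
  intro i0
  have hz0 : ∀ v ∈ b, v ≠ 1 → (φ i0 v : L) = 0 := by
    intro v hv hv1
    have e := hzero v hv
    rw [if_neg hv1, sub_zero] at e
    rw [Fintype.linearIndependent_iff] at hli
    have := hli (fun i => ⟨φ i v, (φ i v).2.2⟩) (by
      rw [← e]
      refine Finset.sum_congr rfl fun i _ => ?_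
      rw [Algebra.smul_def]; rfl) i0
    exact congrArg Subtype.val this
  have hci : (c i0 : L) = φ i0 1 := by
    rw [← hφ i0, Finset.sum_eq_single 1]
    · rw [Subfield.smul_def]; simp
    · intro v hv hv1
      rw [Subfield.smul_def, hz0 v hv hv1]; simp
    · intro h; exact absurd h1b' h
  obtain ⟨u, hu⟩ := (φ i0 1).2.1
  exact ⟨u, by rw [IntermediateField.algebraMap_apply, hci, ← hu]; rfl⟩

lemma induct (p e : ℕ) [Fact p.Prime] [CharP K p] [CharP L p]
    (hA : ∀ i < e, ∀ D : L →ₗ[K] L, IsDiffOpLE K L (p ^ i) D → D ∈ Submodule.span L (Adiff K L p i))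
    (i : ℕ) (hi : i ≤ e) :
    (∃ (n : ℕ) (x : Fin n → L) (ε : Fin n → ℕ), Box (Vm K L p i) L p x ε) ∧
    ∀ y : L, (∀ D : L →ₗ[K] L, IsDiffOpLE K L (p ^ i) D → D y = y * D 1) → y ∈ Vm K L p i := by
  have hp : p.Prime := Fact.out
  induction i with
  | zero =>
    rw [Vm_zero]
    refine ⟨⟨0, Fin.elim0, Fin.elim0, fun j => j.elim0, ?_, ?_⟩, fun _ _ => trivial⟩
    · rw [eq_top_iff]
      intro z _
      exact IntermediateField.algebraMap_mem _ (⟨z, trivial⟩ : (⊤ : IntermediateField K L))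
    · simp
  | succ i ih =>
    obtain ⟨⟨n, x, ε, hbox⟩, hC⟩ := ih (by omega)
    have hC' : ∀ y : L, (∀ D : L →ₗ[K] L, IsDiffOpLE K L (p ^ i) D → D y = y * D 1) →
        y ∈ Vm K L p (i + 1) := by
      intro y hy
      by_contra hc
      have hyF := hC y hy
      have : CharP (Vm K L p i) p := charP_of_injective_algebraMap (algebraMap K (Vm K L p i)).injective p
      obtain ⟨d, hd, hdy⟩ := exists_der (K := K) (F := Vm K L p i) p
        ((Vm K L p (i + 1)).comap (Vm K L p i).val) (by
          rintro ⟨z, hz⟩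
          change z ^ p ∈ Vm K L p (i + 1)
          have : Vm K L p i ≤ frobPre p (Vm K L p (i + 1)) := by
            rw [Vm_le]; intro y; rw [mem_frobPre, ← pow_mul, ← pow_succ]; exact mem_Vm p _ y
          exact this hz) ⟨y, hyF⟩ hc
      obtain ⟨D, hD, hD1, hDF⟩ := ext_der (Vm K L p i) hbox i (mem_Vm p i) d hd
      have e1 := hy D hD
      have e2 := hDF ⟨y, hyF⟩
      rw [hD1, mul_zero] at e1
      apply hdy
      apply Subtype.ext
      rw [← e2]
      exact e1
    refine ⟨?_, fun y hy => hC' y fun D hD => hy D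
      (isDiff_mono (Nat.pow_le_pow_right hp.pos (Nat.le_succ i)) D hD)⟩
    refine sweedler p (i + 1) (fun y => ⟨⟨_, mem_Vm p (i + 1) y⟩, rfl⟩) ?_
    intro m hm
    exact hld_of p i m (by omega) (hA i (by omega)) hC'

lemma box_bot (p : ℕ) {n : ℕ} {x : Fin n → L} {ε : Fin n → ℕ} (V : IntermediateField K L)
    (hV : V = ⊥) (h : Box V L p x ε) : Box K L p x ε := by
  subst hV
  refine ⟨fun j => ?_, ?_, ?_⟩
  · obtain ⟨⟨a, ha⟩, h2⟩ := h.mem j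
    rw [← h2]
    exact IntermediateField.mem_bot.1 ha
  · rw [eq_top_iff]
    intro z _
    have hz : z ∈ (IntermediateField.adjoin (⊥ : IntermediateField K L) (Set.range x)).restrictScalars K := by
      rw [h.top]; trivial
    rw [IntermediateField.restrictScalars_adjoin] at hz
    have : IntermediateField.adjoin K (((⊥ : IntermediateField K L) : Set L) ∪ Set.range x) ≤
        IntermediateField.adjoin K (Set.range x) := by
      rw [IntermediateField.adjoin_le_iff]
      rintro w (hw | hw)
      · exact (bot_le : ⊥ ≤ IntermediateField.adjoin K (Set.range x)) hw
      · exact IntermediateField.subset_adjoin K _ hw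
    exact this hz
  · rw [← h.rank, ← Module.finrank_mul_finrank K (⊥ : IntermediateField K L) L]
    simp

end LD
end ModDiff

/-- **main theorem.** A finite purely inseparable extension `L/K` of
exponent `e` in characteristic `p > 0` is modular iff for every `0 < i ≤ e - 1` the
set `A_{L/K,i}` spans `Diff^{pⁱ}_K L` as an `L`-subspace of `End_K L`. -/
theorem isModular_iff_Adiff_spans
    (K L : Type*) [Field K] [Field L] [Algebra K L] [FiniteDimensional K L]
    (p : ℕ) (hp : p.Prime) [CharP K p]
    (hins : ∀ y : L, ∃ m : ℕ, y ^ p ^ m ∈ (algebraMap K L).range)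
    (e : ℕ) (he : ∀ y : L, y ^ p ^ e ∈ (algebraMap K L).range)
    (hmin : ∀ e' : ℕ, (∀ y : L, y ^ p ^ e' ∈ (algebraMap K L).range) → e ≤ e') :
    IsModular K L ↔
      ∀ i : ℕ, 0 < i → i ≤ e - 1 →
        ∀ D : L →ₗ[K] L, IsDiffOpLE K L (p ^ i) D →
          D ∈ Submodule.span L (Adiff K L p i) := by
  have : Fact p.Prime := ⟨hp⟩
  have : CharP L p := charP_of_injective_algebraMap (algebraMap K L).injective p
  constructor
  · intro h i _ _ D hD
    obtain ⟨n, x, ε, hbox⟩ := ModDiff.exists_box_of_isModular p hp hins h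
    exact ModDiff.span_of_box hp hbox i D hD
  · intro h
    obtain ⟨⟨n, x, ε, hbox⟩, _⟩ := ModDiff.induct (K := K) (L := L) p e (by
      intro i hi D hD
      rcases Nat.eq_zero_or_pos i with rfl | h0
      · refine Submodule.subset_span ⟨hD, fun j hj y => ?_⟩
        obtain rfl : j = 0 := by omega
        exact ⟨D (y ^ p ^ 0), by simp⟩
      · exact h i h0 (by omega) D hD) e le_rfl
    exact (ModDiff.box_bot p _ (ModDiff.Vm_bot p e he) hbox).isModular hp.pos
end

section
/- Let K be a field of characteristic p > 0 and L/K a finite purely inseparable field extension that is NOT modular. Then there exist nonnegative integers i, j, l with i, j ≤ l, elements a ∈ L^{p^i} and b ∈ L^{p^j}, and a differential operator D ∈ Diff^{p^l}_K L such that D(a) ∈ L^{p^i} but D(b) ∉ L^{p^j}; in particular D ∉ A_{L/K,l} and D does not lie in the L-span of A_{L/K,l}. -/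
open scoped TensorProduct

/-- Linear disjointness from the spanning property. -/
lemma pow_linearIndepOn_aux {K L : Type*} [Field K] [Field L] [Algebra K L]
    (p : ℕ) (hp : p.Prime) [CharP K p] (j : ℕ) (A : Set (L →ₗ[K] L))
    (hA : ∀ D ∈ A, ∀ y : L, ∃ z : L, D (y ^ p ^ j) = z ^ p ^ j)
    (hspan : ∀ E : L →ₗ[K] L, E ∈ Submodule.span L A)
    (Lj : IntermediateField K L) (hLj : ∀ u, u ∈ Lj ↔ u ^ p ^ j ∈ (algebraMap K L).range)
    {ι : Type*} (y : ι → L) (hy : LinearIndependent Lj y) (s : Finset ι) :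
    LinearIndepOn K (fun i => y i ^ p ^ j) (s : Set ι) := by
  classical
  have : Fact p.Prime := ⟨hp⟩
  have : CharP L p := charP_of_injective_algebraMap (algebraMap K L).injective p
  induction s using Finset.induction_on with
  | empty => simp
  | insert i0 s hi0 ih =>
    rw [Finset.coe_insert, linearIndepOn_insert (by simpa using hi0)]
    refine ⟨ih, fun hmem => ?_⟩
    rw [← Finset.coe_image] at hmem
    have hmem' : ∃ c : ι → K, ∑ i ∈ s, c i • y i ^ p ^ j = y i0 ^ p ^ j := by
      rw [Finset.coe_image] at hmem
      rw [Submodule.mem_span_image_finset_iff_exists_fun] at hmem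
      obtain ⟨c, hc⟩ := hmem
      refine ⟨fun i => if h : i ∈ s then c ⟨i, h⟩ else 0, ?_⟩
      rw [← hc, ← Finset.sum_coe_sort]
      exact Finset.sum_congr rfl fun i _ => by simp
    obtain ⟨c, hc⟩ := hmem'
    let F : Subfield L := (iterateFrobenius L p j).fieldRange
    have hF : ∀ z : L, z ^ p ^ j ∈ F := fun z => ⟨z, by simp [iterateFrobenius_def]⟩
    by_cases hall : ∀ i ∈ s, algebraMap K L (c i) ∈ F
    · -- all coefficients are powers
      have hu : ∀ i, ∃ u : Lj, i ∈ s → (u : L) ^ p ^ j = algebraMap K L (c i) := by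
        intro i
        by_cases hi : i ∈ s
        · obtain ⟨u, hu⟩ := hall i hi
          rw [iterateFrobenius_def] at hu
          exact ⟨⟨u, (hLj u).2 ⟨c i, hu.symm⟩⟩, fun _ => hu⟩
        · exact ⟨0, fun h => absurd h hi⟩
      choose u hu using hu
      have h1 : (∑ i ∈ s, u i • y i) ^ p ^ j = y i0 ^ p ^ j := by
        rw [sum_pow_char_pow, ← hc]
        refine Finset.sum_congr rfl fun i hi => ?_
        rw [Algebra.smul_def (c i), ← hu i hi, IntermediateField.smul_def, smul_eq_mul, mul_pow]
      have h2 : ∑ i ∈ s, u i • y i = y i0 := by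
        have := iterateFrobenius_inj L p j
        exact this (by simpa only [iterateFrobenius_def] using h1)
      have h3 := (linearIndepOn_insert (K := Lj) (f := y) (s := (s : Set ι)) (a := i0)
        (by simpa using hi0)).1 (hy.linearIndepOn _ )
      apply h3.2
      rw [← h2]
      exact Submodule.sum_mem _ fun i hi => Submodule.smul_mem _ _
        (Submodule.subset_span ⟨i, hi, rfl⟩)
    · push Not at hall
      obtain ⟨i1, hi1, hci1⟩ := hall
      have hni : algebraMap K L (c i1) ∉ Submodule.span F {(1 : L)} := by
        intro h
        obtain ⟨a, ha⟩ := Submodule.mem_span_singleton.1 h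
        apply hci1
        rw [← ha, Subfield.smul_def, smul_eq_mul, mul_one]
        exact a.2
      obtain ⟨φ, hφ, hker⟩ := Submodule.exists_le_ker_of_notMem hni
      have hφ1 : φ 1 = 0 := hker (Submodule.mem_span_singleton_self _)
      have hφF : ∀ (f : L) (hf : f ∈ F) z, φ (f * z) = (⟨f, hf⟩ : F) * φ z := by
        intro f hf z
        rw [← smul_eq_mul (a := (⟨f, hf⟩ : F)), ← map_smul]; rfl
      have key : ∀ E : L →ₗ[K] L,
          ∑ i ∈ s, (φ (algebraMap K L (c i)) : L) * E (y i ^ p ^ j) = 0 := by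
        intro E
        refine Submodule.span_induction (p := fun E _ =>
          ∑ i ∈ s, (φ (algebraMap K L (c i)) : L) * E (y i ^ p ^ j) = 0) ?_ ?_ ?_ ?_ (hspan E)
        · intro D hD
          have hDF : ∀ i, D (y i ^ p ^ j) ∈ F := fun i => by
            obtain ⟨z, hz⟩ := hA D hD (y i)
            rw [hz]; exact hF z
          have e1 : ∑ i ∈ s, D (y i ^ p ^ j) * algebraMap K L (c i) = D (y i0 ^ p ^ j) * 1 := by
            rw [← hc, map_sum, mul_one]
            refine Finset.sum_congr rfl fun i _ => ?_
            rw [map_smul, Algebra.smul_def, mul_comm]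
          have e2 := congrArg φ e1
          rw [map_sum, hφF _ (hDF i0), hφ1, mul_zero] at e2
          have e3 := congrArg (fun t : F => (t : L)) e2
          simp only [hφF _ (hDF _)] at e3
          push_cast at e3
          rw [← e3]
          exact Finset.sum_congr rfl fun i _ => mul_comm _ _
        · simp
        · intro D1 D2 _ _ h1 h2
          simp only [LinearMap.add_apply, mul_add, Finset.sum_add_distrib, h1, h2, add_zero]
        · intro a D _ h
          simp only [LinearMap.smul_apply, smul_eq_mul, mul_left_comm _ a, ← Finset.mul_sum, h,
            mul_zero]
      have hins : insert i1 ((s.erase i1 : Finset ι) : Set ι) = (s : Set ι) := by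
        rw [← Finset.coe_insert, Finset.insert_erase hi1]
      rw [← hins, linearIndepOn_insert (by simp)] at ih
      obtain ⟨E, hE0, hE1⟩ := LinearMap.exists_extend_of_notMem
        (0 : Submodule.span K ((fun i => y i ^ p ^ j) '' ((s.erase i1 : Finset ι) : Set ι)) →ₗ[K] L)
        ih.2 1
      have h := key E
      rw [Finset.sum_eq_single_of_mem i1 hi1] at h
      · rw [hE1, mul_one] at h
        exact hφ (by exact_mod_cast h)
      · intro i hi hne
        have := congrArg (fun g => g ⟨y i ^ p ^ j, Submodule.subset_span
          ⟨i, by simpa using ⟨hi, hne⟩, rfl⟩⟩) hE0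
        simp only [LinearMap.comp_apply, Submodule.subtype_apply, LinearMap.zero_apply] at this
        rw [this, mul_zero]

/-- The action of `L ⊗ L` on endomorphisms by left and right multiplication. -/
noncomputable def biAct (K L : Type*) [Field K] [Field L] [Algebra K L] :
    L ⊗[K] L →ₐ[K] Module.End K (L →ₗ[K] L) :=
  Algebra.TensorProduct.lift
    (AlgHom.ofLinearMap
      { toFun := fun c => LinearMap.mulLeft K (LinearMap.mulLeft K c : Module.End K L)
        map_add' := by intros; ext; simp [add_mul]
        map_smul' := by intros; ext; simp }
      (by ext; simp) (by intros; ext; simp))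
    (AlgHom.ofLinearMap
      { toFun := fun c => LinearMap.mulRight K (LinearMap.mulLeft K c : Module.End K L)
        map_add' := by intros; ext; simp [add_mul]
        map_smul' := by intros; ext; simp }
      (by ext; simp) (by intros; ext; simp [mul_left_comm]))
    (fun x y => by
      rw [commute_iff_eq]; ext; simp)

lemma biAct_apply {K L : Type*} [Field K] [Field L] [Algebra K L] (c : L) (D : L →ₗ[K] L) :
    biAct K L (1 ⊗ₜ c - c ⊗ₜ 1) D = D ∘ₗ LinearMap.mulLeft K c - LinearMap.mulLeft K c ∘ₗ D := by
  ext x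
  simp [biAct]

lemma foldl_biAct {K L : Type*} [Field K] [Field L] [Algebra K L] (t : List L) (D : L →ₗ[K] L) :
    t.foldl (fun E c => E ∘ₗ LinearMap.mulLeft K c - LinearMap.mulLeft K c ∘ₗ E) D
      = biAct K L (t.map fun c => (1 ⊗ₜ c - c ⊗ₜ 1 : L ⊗[K] L)).prod D := by
  induction t generalizing D with
  | nil => simp
  | cons c t ih =>
    rw [List.foldl_cons, ih, ← biAct_apply, List.map_cons, List.prod_cons, mul_comm, map_mul]
    rfl

lemma exists_all_diffOp (K L : Type*) [Field K] [Field L] [Algebra K L] [FiniteDimensional K L]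
    (p : ℕ) (hp : p.Prime) [CharP K p]
    (hins : ∀ y : L, ∃ m : ℕ, y ^ p ^ m ∈ (algebraMap K L).range) :
    ∃ N : ℕ, ∀ n, N ≤ n → ∀ D : L →ₗ[K] L, IsDiffOpLE K L n D := by
  have : Fact p.Prime := ⟨hp⟩
  have : CharP (L ⊗[K] L) p :=
    charP_of_injective_algebraMap (algebraMap K (L ⊗[K] L)).injective p
  have : IsNoetherianRing (L ⊗[K] L) := isNoetherian_of_tower K inferInstance
  obtain ⟨N, hN⟩ := IsNoetherianRing.isNilpotent_nilradical (L ⊗[K] L)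
  refine ⟨N, fun n hn D a => ?_⟩
  rw [foldl_biAct]
  have hmem : ∀ c : L, (1 ⊗ₜ c - c ⊗ₜ 1 : L ⊗[K] L) ∈ nilradical (L ⊗[K] L) := by
    intro c
    obtain ⟨m, k, hk⟩ := hins c
    refine ⟨p ^ m, ?_⟩
    rw [sub_pow_char_pow, Algebra.TensorProduct.tmul_pow, Algebra.TensorProduct.tmul_pow, ← hk,
      one_pow, Algebra.algebraMap_eq_smul_one, TensorProduct.tmul_smul, TensorProduct.smul_tmul',
      sub_self]
    exact zero_mem _
  have h : ∀ t : List L, (t.map fun c => (1 ⊗ₜ c - c ⊗ₜ 1 : L ⊗[K] L)).prod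
      ∈ nilradical (L ⊗[K] L) ^ t.length := by
    intro t
    induction t with
    | nil => simp
    | cons c t ih =>
      rw [List.map_cons, List.prod_cons, List.length_cons, pow_succ']
      exact Ideal.mul_mem_mul (hmem c) ih
  have h0 := Ideal.pow_le_pow_right (by simp; omega) (h (List.ofFn a)) (m := N)
  rw [hN, Ideal.zero_eq_bot, Ideal.mem_bot] at h0
  rw [h0]
  simp

/-- The elements of `L` whose `p^j`-th power lies in `K`. -/
def rootField (K L : Type*) [Field K] [Field L] [Algebra K L]
    (p : ℕ) [Fact p.Prime] [CharP L p] (j : ℕ) : IntermediateField K L where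
  carrier := {u | u ^ p ^ j ∈ (algebraMap K L).range}
  mul_mem' := fun ha hb => by
    simp only [Set.mem_ofPred_eq, mul_pow] at *
    exact mul_mem ha hb
  add_mem' := fun ha hb => by
    simp only [Set.mem_ofPred_eq, add_pow_char_pow] at *
    exact add_mem ha hb
  algebraMap_mem' := fun r => ⟨r ^ p ^ j, by simp⟩
  inv_mem' := fun x hx => by
    obtain ⟨k, hk⟩ := hx
    exact ⟨k⁻¹, by rw [map_inv₀, hk, inv_pow]⟩

lemma mem_rootField {K L : Type*} [Field K] [Field L] [Algebra K L]
    {p : ℕ} [Fact p.Prime] [CharP L p] {j : ℕ} {u : L} :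
    u ∈ rootField K L p j ↔ u ^ p ^ j ∈ (algebraMap K L).range := Iff.rfl

/-- the `K`-span of the `p^j`-th powers -/
def powSpan (K L : Type*) [Field K] [Field L] [Algebra K L] (p j : ℕ) : Submodule K L :=
  Submodule.span K (Set.range fun y : L => y ^ p ^ j)

/-- (B) -/
lemma finrank_powSpan_le {K L : Type*} [Field K] [Field L] [Algebra K L] [FiniteDimensional K L]
    (p : ℕ) [Fact p.Prime] [CharP L p] (j : ℕ) (F : IntermediateField K L)
    (hF : rootField K L p j ≤ F) (hFp : ∀ y : L, y ^ p ∈ F) :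
    Module.finrank K (powSpan K L p (j + 1)) ≤
      IntermediateField.relfinrank (rootField K L p j) F := by
  rw [IntermediateField.relfinrank_eq_finrank_of_le hF]
  set F' := IntermediateField.extendScalars hF with hF'
  let b := Module.finBasis (rootField K L p j) F'
  have hle : powSpan K L p (j + 1) ≤
      Submodule.span K (Set.range fun i => ((b i : F') : L) ^ p ^ j) := by
    refine Submodule.span_le.2 ?_
    rintro _ ⟨w, rfl⟩
    have hw := congrArg (fun z : F' => (z : L) ^ p ^ j) (b.sum_repr ⟨w ^ p, hFp w⟩)
    simp only at hw
    rw [← pow_mul, ← pow_succ'] at hw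
    simp only [SetLike.mem_coe]
    rw [← hw]
    push_cast
    rw [sum_pow_char_pow]
    refine Submodule.sum_mem _ fun i _ => ?_
    obtain ⟨k, hk⟩ := (b.repr ⟨w ^ p, hFp w⟩ i).2
    rw [IntermediateField.smul_def, smul_eq_mul, mul_pow, ← hk, ← Algebra.smul_def]
    exact Submodule.smul_mem _ _ (Submodule.subset_span ⟨i, rfl⟩)
  refine (Submodule.finrank_mono hle).trans ?_
  refine (finrank_range_le_card _).trans ?_
  simp

/-- (A) -/
lemma le_finrank_powSpan {K L : Type*} [Field K] [Field L] [Algebra K L] [FiniteDimensional K L]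
    (p : ℕ) (hp : p.Prime) [CharP K p] [Fact p.Prime] [CharP L p] (j : ℕ) (A : Set (L →ₗ[K] L))
    (hA : ∀ D ∈ A, ∀ y : L, ∃ z : L, D (y ^ p ^ j) = z ^ p ^ j)
    (hspan : ∀ E : L →ₗ[K] L, E ∈ Submodule.span L A) :
    Module.finrank (rootField K L p j) L ≤ Module.finrank K (powSpan K L p j) := by
  let b := Module.finBasis (rootField K L p j) L
  have h := pow_linearIndepOn_aux p hp j A hA hspan (rootField K L p j) (fun _ => mem_rootField)
    b b.linearIndependent Finset.univ
  rw [Finset.coe_univ, linearIndepOn_univ_iff] at h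
  have h2 := finrank_span_eq_card h
  rw [Fintype.card_fin] at h2
  rw [← h2]
  refine Submodule.finrank_mono (Submodule.span_mono ?_)
  rintro _ ⟨i, rfl⟩
  exact ⟨b i, rfl⟩


lemma finrank_anti {K L : Type*} [Field K] [Field L] [Algebra K L] [FiniteDimensional K L]
    {A B : IntermediateField K L} (h : A ≤ B) : Module.finrank B L ≤ Module.finrank A L := by
  rw [← IntermediateField.relfinrank_mul_finrank_top h]
  exact Nat.le_of_dvd (by
    rw [IntermediateField.relfinrank_mul_finrank_top h]; exact Module.finrank_pos) ⟨_, mul_comm _ _⟩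

lemma finrank_adjoin_p {N L : Type*} [Field N] [Field L] [Algebra N L] [FiniteDimensional N L]
    (p : ℕ) [Fact p.Prime] [CharP L p] (x : L) (hx : x ∉ (algebraMap N L).range)
    (hxp : x ^ p ∈ (algebraMap N L).range) :
    Module.finrank N (IntermediateField.adjoin N {x}) = p := by
  obtain ⟨a, ha⟩ := hxp
  have hp : p.Prime := Fact.out
  have hirr : Irreducible (Polynomial.X ^ p - Polynomial.C a : Polynomial N) := by
    refine X_pow_sub_C_irreducible_of_prime hp fun b hb => hx ⟨b, ?_⟩
    apply frobenius_inj L p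
    rw [frobenius_def, frobenius_def, ← map_pow, hb, ha]
  rw [IntermediateField.adjoin.finrank (Algebra.IsIntegral.isIntegral x),
    ← minpoly.eq_of_irreducible_of_monic hirr (by simp [ha]) (Polynomial.monic_X_pow_sub_C _ hp.ne_zero),
    Polynomial.natDegree_X_pow_sub_C]

lemma exists_chain {K L : Type*} [Field K] [Field L] [Algebra K L] [FiniteDimensional K L]
    (p : ℕ) [Fact p.Prime] [CharP L p]
    (hins : ∀ y : L, ∃ m : ℕ, y ^ p ^ m ∈ (algebraMap K L).range) (d : ℕ) :
    ∀ N : IntermediateField K L, (∀ y : L, y ^ p ∈ N) → Module.finrank N L ≤ d →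
    ∃ (n : ℕ) (x : Fin n → L) (r : Fin n → ℕ),
      (∀ i, x i ^ p ^ r i ∈ (algebraMap K L).range) ∧
      N ⊔ IntermediateField.adjoin K (Set.range x) = ⊤ ∧
      ∀ j, p ^ (∑ i, if j < r i then 1 else 0) ≤
        Module.finrank ↥(N ⊔ rootField K L p j) L := by
  have hp : p.Prime := Fact.out
  induction d with
  | zero =>
    intro N _ h
    have : 0 < Module.finrank N L := Module.finrank_pos
    omega
  | succ d ih =>
    intro N hN hd
    by_cases htop : N = ⊤
    · refine ⟨0, Fin.elim0, Fin.elim0, fun i => i.elim0, by simp [htop], fun j => ?_⟩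
      simpa using! Nat.succ_le_of_lt (Module.finrank_pos (R := ↥(N ⊔ rootField K L p j)) (M := L))
    classical
    have hex : ∃ m : ℕ, ∃ x : L, x ∉ N ∧ x ^ p ^ m ∈ (algebraMap K L).range := by
      by_contra hcon
      push Not at hcon
      apply htop
      rw [eq_top_iff]
      intro x _
      by_contra hx
      obtain ⟨m, hm⟩ := hins x
      exact hcon m x hx hm
    obtain ⟨x, hxN, hxr⟩ := Nat.find_spec hex
    have hmin : ∀ j, j < Nat.find hex → rootField K L p j ≤ N := by
      intro j hj u hu
      by_contra huN
      exact Nat.find_min hex hj ⟨u, huN, hu⟩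
    set r0 := Nat.find hex
    let N1 := IntermediateField.adjoin N {x}
    have h1 : Module.finrank N N1 = p := by
      refine finrank_adjoin_p p x ?_ ⟨⟨x ^ p, hN x⟩, rfl⟩
      rintro ⟨y, rfl⟩
      exact hxN y.2
    let N' : IntermediateField K L := N1.restrictScalars K
    have hN' : N' = N ⊔ IntermediateField.adjoin K {x} := by
      change (IntermediateField.adjoin N {x}).restrictScalars K = _
      rw [IntermediateField.restrictScalars_adjoin]
      refine le_antisymm (IntermediateField.adjoin_le_iff.2 ?_) (sup_le ?_ ?_)
      · rintro y (hy | hy)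
        · exact (le_sup_left : N ≤ N ⊔ IntermediateField.adjoin K {x}) hy
        · exact (le_sup_right : _ ≤ N ⊔ IntermediateField.adjoin K {x})
            (IntermediateField.subset_adjoin K _ hy)
      · intro y hy
        exact IntermediateField.subset_adjoin K _ (Or.inl hy)
      · exact IntermediateField.adjoin.mono K _ _ Set.subset_union_right
    have h2 : p * Module.finrank N' L = Module.finrank N L := by
      rw [← h1]; exact Module.finrank_mul_finrank N N1 L
    have hle : N ≤ N' := hN' ▸ le_sup_left
    have hpos : 0 < Module.finrank N' L := Module.finrank_pos
    obtain ⟨n, x', r', hx', hgen, hcount⟩ := ih N' (fun y => hle (hN y)) (by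
      have := hp.two_le
      nlinarith)
    refine ⟨n + 1, Fin.cons x x', Fin.cons r0 r', ?_, ?_, ?_⟩
    · intro i
      refine Fin.cases ?_ (fun i => ?_) i
      · simpa using hxr
      · simpa using hx' i
    · rw [← hgen, hN', sup_assoc, Fin.range_cons, Set.insert_eq, IntermediateField.adjoin_union]
    · intro j
      rw [Fin.sum_univ_succ]
      simp only [Fin.cons_zero, Fin.cons_succ]
      by_cases hj : j < r0
      · rw [if_pos hj, pow_add, pow_one, sup_eq_left.2 (hmin j hj), ← h2]
        exact Nat.mul_le_mul_left _ ((hcount j).trans (finrank_anti le_sup_left))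
      · rw [if_neg hj, zero_add]
        exact (hcount j).trans (finrank_anti (sup_le_sup_right hle _))

lemma finrank_adjoin_le {K L : Type*} [Field K] [Field L] [Algebra K L] [FiniteDimensional K L]
    (q : ℕ) (hq : q ≠ 0) (x : L) (hx : x ^ q ∈ (algebraMap K L).range) :
    Module.finrank K (IntermediateField.adjoin K {x}) ≤ q := by
  obtain ⟨a, ha⟩ := hx
  rw [IntermediateField.adjoin.finrank (Algebra.IsIntegral.isIntegral x)]
  have := Polynomial.natDegree_le_of_dvd
    (minpoly.dvd K x (p := Polynomial.X ^ q - Polynomial.C a) (by simp [ha]))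
    (Polynomial.monic_X_pow_sub_C _ hq).ne_zero
  rwa [Polynomial.natDegree_X_pow_sub_C] at this

lemma modularMulMap_surjective {K L : Type*} [Field K] [Field L] [Algebra K L]
    [FiniteDimensional K L] {n : ℕ} (x : Fin n → L)
    (h : IntermediateField.adjoin K (Set.range x) = ⊤) :
    Function.Surjective (modularMulMap (K := K) x) := by
  classical
  let φ : (⨂[K] i, ↥(IntermediateField.adjoin K {x i})) →ₐ[K] L :=
    PiTensorProduct.liftAlgHom ((MultilinearMap.mkPiAlgebra K (Fin n) L).compLinearMap
      fun i => (IntermediateField.adjoin K {x i}).val.toLinearMap) (by simp)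
      (by intro a b; simp [Finset.prod_mul_distrib])
  have hφ : ∀ t, modularMulMap x t = φ t := fun t => rfl
  have hr : φ.range = ⊤ := by
    rw [eq_top_iff, ← IntermediateField.top_toSubalgebra, ← h,
      IntermediateField.adjoin_toSubalgebra_of_isAlgebraic
        (fun y _ => Algebra.IsAlgebraic.isAlgebraic y), Algebra.adjoin_le_iff]
    rintro _ ⟨i, rfl⟩
    refine ⟨PiTensorProduct.tprod K (Function.update 1 i
      ⟨x i, IntermediateField.mem_adjoin_simple_self K (x i)⟩), ?_⟩
    refine (hφ _).symm.trans ?_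
    rw [modularMulMap, PiTensorProduct.lift.tprod]
    simp only [MultilinearMap.compLinearMap_apply, MultilinearMap.mkPiAlgebra_apply]
    rw [Finset.prod_eq_single i]
    · simp
    · intro k _ hk
      simp [Function.update_of_ne hk]
    · simp
  intro y
  have : y ∈ φ.range := hr ▸ Algebra.mem_top
  obtain ⟨t, ht⟩ := this
  exact ⟨t, ht⟩

lemma isModular_of_le {K L : Type*} [Field K] [Field L] [Algebra K L] [FiniteDimensional K L]
    (p : ℕ) [Fact p.Prime] [CharP L p]
    (hins : ∀ y : L, ∃ m : ℕ, y ^ p ^ m ∈ (algebraMap K L).range)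
    (hle : ∀ j, Module.finrank (rootField K L p j) L ≤ Module.finrank K (powSpan K L p j)) :
    IsModular K L := by
  have hp : p.Prime := Fact.out
  let N : IntermediateField K L := IntermediateField.adjoin K (Set.range fun y : L => y ^ p)
  have hN : ∀ y : L, y ^ p ∈ N := fun y => IntermediateField.subset_adjoin K _ ⟨y, rfl⟩
  obtain ⟨n, x, r, hx, hgen, hcount⟩ := exists_chain p hins _ N hN le_rfl
  have hstep : ∀ j, p ^ (∑ i, if j < r i then 1 else 0) * Module.finrank K (powSpan K L p (j + 1))
      ≤ Module.finrank K (powSpan K L p j) := by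
    intro j
    refine le_trans ?_ (hle j)
    have hsub : rootField K L p j ≤ N ⊔ rootField K L p j := le_sup_right
    rw [← IntermediateField.relfinrank_mul_finrank_top hsub, mul_comm]
    exact Nat.mul_le_mul (finrank_powSpan_le p j _ hsub
      fun y => (le_sup_left : N ≤ N ⊔ rootField K L p j) (hN y)) (hcount j)
  have htel : ∀ m, p ^ (∑ j ∈ Finset.range m, ∑ i, if j < r i then 1 else 0) *
      Module.finrank K (powSpan K L p m) ≤ Module.finrank K L := by
    intro m
    induction m with
    | zero => simpa using Submodule.finrank_le _
    | succ m ih =>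
      refine le_trans ?_ ih
      rw [Finset.sum_range_succ, pow_add, mul_assoc]
      exact Nat.mul_le_mul_left _ (hstep m)
  have hsum : ∑ j ∈ Finset.range (∑ i, r i), ∑ i, (if j < r i then 1 else 0) = ∑ i, r i := by
    rw [Finset.sum_comm]
    refine Finset.sum_congr rfl fun i _ => ?_
    rw [← Finset.card_filter]
    have : (Finset.range (∑ i, r i)).filter (fun j => j < r i) = Finset.range (r i) := by
      ext j
      have := Finset.single_le_sum (f := r) (fun _ _ => Nat.zero_le _) (Finset.mem_univ i)
      simp only [Finset.mem_filter, Finset.mem_range]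
      omega
    rw [this, Finset.card_range]
  have hbig : p ^ (∑ i, r i) ≤ Module.finrank K L := by
    have h := htel (∑ i, r i)
    rw [hsum] at h
    refine le_trans (Nat.le_mul_of_pos_right _ ?_) h
    have h1 : (1 : L) ∈ powSpan K L p (∑ i, r i) := Submodule.subset_span ⟨1, one_pow _⟩
    have : Nontrivial (powSpan K L p (∑ i, r i)) :=
      ⟨⟨⟨1, h1⟩, 0, fun h => one_ne_zero (congrArg Subtype.val h)⟩⟩
    exact Module.finrank_pos
  -- generation
  have hG : IntermediateField.adjoin K (Set.range x) = ⊤ := by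
    set G := IntermediateField.adjoin K (Set.range x) with hGdef
    have hind : ∀ m, G ⊔ IntermediateField.adjoin K (Set.range fun y : L => y ^ p ^ m) = ⊤ := by
      intro m
      induction m with
      | zero =>
        rw [eq_top_iff]
        intro y _
        exact (le_sup_right : _ ≤ G ⊔ _) (IntermediateField.subset_adjoin K _ ⟨y, by simp⟩)
      | succ m ih =>
        rw [← ih]
        refine le_antisymm (ih ▸ le_top) (sup_le le_sup_left ?_)
        rw [IntermediateField.adjoin_le_iff]
        set H := G ⊔ IntermediateField.adjoin K (Set.range fun y : L => y ^ p ^ (m + 1)) with hH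
        let C : IntermediateField K L :=
          { carrier := {u | u ^ p ^ m ∈ H}
            mul_mem' := fun ha hb => by
              simp only [Set.mem_ofPred_eq, mul_pow] at *
              exact mul_mem ha hb
            add_mem' := fun ha hb => by
              simp only [Set.mem_ofPred_eq, add_pow_char_pow] at *
              exact add_mem ha hb
            algebraMap_mem' := fun k => pow_mem (H.algebraMap_mem k) _
            inv_mem' := fun u hu => by
              change u⁻¹ ^ p ^ m ∈ H
              rw [inv_pow]
              exact inv_mem hu }
        have hC : C = ⊤ := by
          rw [eq_top_iff, ← hgen]
          refine sup_le ?_ ?_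
          · rw [IntermediateField.adjoin_le_iff]
            rintro _ ⟨y, rfl⟩
            change (y ^ p) ^ p ^ m ∈ H
            rw [← pow_mul, ← pow_succ']
            exact (le_sup_right : _ ≤ H) (IntermediateField.subset_adjoin K _ ⟨y, rfl⟩)
          · intro u hu
            exact pow_mem ((le_sup_left : G ≤ H) hu) _
        rintro _ ⟨y, rfl⟩
        have : y ∈ C := hC ▸ IntermediateField.mem_top
        exact this
    obtain ⟨e, he⟩ : ∃ e, ∀ y : L, y ^ p ^ e ∈ (algebraMap K L).range := by
      choose f hf using hins
      let b := Module.finBasis K L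
      refine ⟨∑ i, f (b i), fun y => ?_⟩
      rw [← b.sum_repr y, sum_pow_char_pow]
      refine Subring.sum_mem _ fun i _ => ?_
      rw [Algebra.smul_def, mul_pow]
      refine mul_mem (pow_mem (RingHom.mem_range_self _ _) _) ?_
      obtain ⟨t, ht⟩ := Nat.exists_eq_add_of_le (Finset.single_le_sum (f := fun i => f (b i))
        (fun _ _ => Nat.zero_le _) (Finset.mem_univ i))
      rw [ht, pow_add, pow_mul]
      exact pow_mem (hf _) _
    rw [← hind e]
    symm
    rw [sup_eq_left, IntermediateField.adjoin_le_iff]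
    rintro _ ⟨y, rfl⟩
    obtain ⟨k, hk⟩ := he y
    simp only [SetLike.mem_coe]
    rw [← hk]
    exact G.algebraMap_mem k
  have hsurj := modularMulMap_surjective x hG
  refine ⟨n, x, ?_, hsurj⟩
  let B := Basis.piTensorProduct fun i => Module.finBasis K ↥(IntermediateField.adjoin K {x i})
  have hfin : Module.Finite K (⨂[K] i, ↥(IntermediateField.adjoin K {x i})) :=
    Module.Finite.of_basis B
  have hcard : Module.finrank K (⨂[K] i, ↥(IntermediateField.adjoin K {x i})) ≤
      Module.finrank K L := by
    rw [Module.finrank_eq_card_basis B, Fintype.card_pi]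
    refine le_trans ?_ hbig
    rw [← Finset.prod_pow_eq_pow_sum]
    refine Finset.prod_le_prod' fun i _ => ?_
    rw [Fintype.card_fin]
    exact finrank_adjoin_le _ (pow_ne_zero _ hp.ne_zero) _ (hx i)
  have hcard2 := LinearMap.finrank_le_finrank_of_surjective hsurj
  exact (LinearMap.injective_iff_surjective_of_finrank_eq_finrank (le_antisymm hcard hcard2)).2 hsurj

/-- If a finite purely inseparable extension `L/K` in characteristic
`p > 0` is not modular, there are `i, j ≤ l`, elements `a ∈ L^{pⁱ}`, `b ∈ L^{pʲ}`
and a differential operator `D` of order ≤ `p ^ l` with `D a ∈ L^{pⁱ}` but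
`D b ∉ L^{pʲ}`; in particular `D ∉ A_{L/K,l}` and `D` is not in the `L`-span of
`A_{L/K,l}`. -/
theorem not_modular_exists_bad_diffOp
    (K L : Type*) [Field K] [Field L] [Algebra K L] [FiniteDimensional K L]
    (p : ℕ) (hp : p.Prime) [CharP K p]
    (hins : ∀ y : L, ∃ m : ℕ, y ^ p ^ m ∈ (algebraMap K L).range)
    (hnotmod : ¬ IsModular K L) :
    ∃ (i j l : ℕ), i ≤ l ∧ j ≤ l ∧
      ∃ (a b : L) (D : L →ₗ[K] L),
        IsDiffOpLE K L (p ^ l) D ∧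
        (∃ a' : L, a = a' ^ p ^ i) ∧
        (∃ b' : L, b = b' ^ p ^ j) ∧
        (∃ c : L, D a = c ^ p ^ i) ∧
        (¬ ∃ c : L, D b = c ^ p ^ j) ∧
        D ∉ Adiff K L p l ∧
        D ∉ Submodule.span L (Adiff K L p l) := by
  classical
  have : Fact p.Prime := ⟨hp⟩
  have : CharP L p := charP_of_injective_algebraMap (algebraMap K L).injective p
  by_contra hcon
  have hall : ∀ l, ∀ D : L →ₗ[K] L, IsDiffOpLE K L (p ^ l) D →
      D ∈ Submodule.span L (Adiff K L p l) := by
    intro l D hD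
    by_contra hns
    have hnA : D ∉ Adiff K L p l := fun h => hns (Submodule.subset_span h)
    have : ∃ j ≤ l, ∃ y : L, ¬ ∃ z : L, D (y ^ p ^ j) = z ^ p ^ j := by
      by_contra h
      push Not at h
      exact hnA ⟨hD, h⟩
    obtain ⟨j, hj, y, hy⟩ := this
    exact hcon ⟨0, j, l, Nat.zero_le _, hj, 0, y ^ p ^ j, D, hD, ⟨0, by simp⟩, ⟨y, rfl⟩,
      ⟨0, by simp⟩, hy, hnA, hns⟩
  obtain ⟨N, hN⟩ := exists_all_diffOp K L p hp hins
  refine hnotmod (isModular_of_le p hins fun j => ?_)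
  refine le_finrank_powSpan p hp j (Adiff K L p (N + j)) (fun D hD => hD.2 j (by omega))
    fun E => hall _ E (hN _ ?_ E)
  exact le_trans (by omega) (Nat.lt_pow_self hp.one_lt).le
end
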